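/- arXiv:2509.20053 — 2 statements merged into one kernel-verified Lean document; each statement's English description precedes it below -/
import Mathlib

section
/- Let k be a field and n ≥ 1. Let φ : NH_n ⊗_k k[t] → NH_{n+1} be the algebra homomorphism sending NH_n onto the first n strands (x_i ↦ x_i, ∂_i ↦ ∂_i) and t ↦ x_{n+1}, and let φ' : NH_{n−1} ⊗_k k[t] → NH_n send NH_{n−1} onto the first n−1 strands and t ↦ x_n. Let k_0 denote k as a k[t]-module with t acting by 0. Define the (NH_n, NH_n)-bimodule M := NH_{n+1} ⊗_{NH_n ⊗ k[t]} (NH_n ⊗_k k_0), where NH_{n+1} is a right (NH_n ⊗ k[t])-module via φ, the left NH_n-action is through NH_n ⊆ NH_{n+1}, and the right NH_n-action is right multiplication on the NH_n tensor factor. Define the (NH_n, NH_n)-bimodule N := NH_n ⊗_{NH_{n−1} ⊗ k[t]} (NH_n ⊗_k k_0), where the left tensor factor NH_n is a right (NH_{n−1} ⊗ k[t])-module via φ', in the right tensor factor NH_{n−1} acts on NH_n by left multiplication through the first-(n−1)-strands embedding and t acts by 0 on k_0, the left NH_n-action is left multiplication on the left factor, and the right NH_n-action is right multiplication on the right NH_n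 factor. Then the map NH_n → M, a ↦ 1 ⊗ (a ⊗ 1), is an injective homomorphism of (NH_n, NH_n)-bimodules, and its cokernel is isomorphic to N as an (NH_n, NH_n)-bimodule, via the map induced by v ⊗ (w ⊗ 1) ↦ class of (v·∂_n) ⊗ (w ⊗ 1); in other words there is a short exact sequence of (NH_n, NH_n)-bimodules 0 → NH_n → M → N → 0. -/
open scoped TensorProduct

/-! ## The nilHecke algebra

For a field `k` and `N : ℕ`, the nilHecke algebra `NH k N` is the quotient of the free
associative `k`-algebra on generators `x_0, …, x_{N-1}` (indexed by `Fin N`) and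
`∂_0, …, ∂_{N-2}` (indexed by `{i : Fin N // i + 1 < N}`) by the nilHecke relations. -/

/-- Index type for the generators `∂_i` of the nilHecke algebra on `N` strands. -/
abbrev DIdx (N : ℕ) : Type := {i : Fin N // (i : ℕ) + 1 < N}

/-- The generators of the nilHecke algebra: `Sum.inl i` is `x_i`, `Sum.inr j` is `∂_j`. -/
abbrev NHGen (N : ℕ) : Type := Fin N ⊕ DIdx N

variable (k : Type) [Field k]

/-- `x_i` in the free algebra. -/
noncomputable abbrev NHx (N : ℕ) (i : Fin N) : FreeAlgebra k (NHGen N) :=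
  FreeAlgebra.ι k (Sum.inl i)

/-- `∂_i` in the free algebra. -/
noncomputable abbrev NHd (N : ℕ) (i : DIdx N) : FreeAlgebra k (NHGen N) :=
  FreeAlgebra.ι k (Sum.inr i)

/-- For `i` an index of a `∂` generator, the element `i+1` of `Fin N`. -/
abbrev DIdx.succ {N : ℕ} (i : DIdx N) : Fin N := ⟨(i.1 : ℕ) + 1, i.2⟩

/-- The defining relations of the nilHecke algebra:
`x_i x_j = x_j x_i`; `∂_i² = 0`; `∂_i ∂_{i+1} ∂_i = ∂_{i+1} ∂_i ∂_{i+1}`;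
`∂_i ∂_j = ∂_j ∂_i` for `|i-j| > 1`; `x_i ∂_j = ∂_j x_i` for `|i-j| > 1`;
`x_i ∂_i - ∂_i x_{i+1} = 1`; `∂_i x_i - x_{i+1} ∂_i = 1`. -/
inductive NHRel (N : ℕ) : FreeAlgebra k (NHGen N) → FreeAlgebra k (NHGen N) → Prop
  | xcomm (i j : Fin N) : NHRel N (NHx k N i * NHx k N j) (NHx k N j * NHx k N i)
  | dsq (i : DIdx N) : NHRel N (NHd k N i * NHd k N i) 0
  | braid (i j : DIdx N) (h : (j.1 : ℕ) = (i.1 : ℕ) + 1) :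
      NHRel N (NHd k N i * NHd k N j * NHd k N i) (NHd k N j * NHd k N i * NHd k N j)
  | ddfar (i j : DIdx N) (h : (i.1 : ℕ) + 1 < (j.1 : ℕ) ∨ (j.1 : ℕ) + 1 < (i.1 : ℕ)) :
      NHRel N (NHd k N i * NHd k N j) (NHd k N j * NHd k N i)
  | xdfar (i : Fin N) (j : DIdx N)
      (h : (i : ℕ) + 1 < (j.1 : ℕ) ∨ (j.1 : ℕ) + 1 < (i : ℕ)) :
      NHRel N (NHx k N i * NHd k N j) (NHd k N j * NHx k N i)
  | xd (i : DIdx N) :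
      NHRel N (NHx k N i.1 * NHd k N i - NHd k N i * NHx k N i.succ) 1
  | dx (i : DIdx N) :
      NHRel N (NHd k N i * NHx k N i.1 - NHx k N i.succ * NHd k N i) 1

/-- The nilHecke algebra on `N` strands over `k`. -/
noncomputable def NH (N : ℕ) : Type := RingQuot (NHRel k N)

noncomputable instance (N : ℕ) : Ring (NH k N) :=
  inferInstanceAs (Ring (RingQuot (NHRel k N)))

noncomputable instance (N : ℕ) : Algebra k (NH k N) :=
  inferInstanceAs (Algebra k (RingQuot (NHRel k N)))

/-- The generator `x_i` of the nilHecke algebra `NH k N`. -/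
noncomputable def xg (N : ℕ) (i : Fin N) : NH k N :=
  RingQuot.mkAlgHom k (NHRel k N) (NHx k N i)

/-- The generator `∂_i` of the nilHecke algebra `NH k N`. -/
noncomputable def dg (N : ℕ) (i : DIdx N) : NH k N :=
  RingQuot.mkAlgHom k (NHRel k N) (NHd k N i)


variable (n : ℕ)

/-- The balancing relations defining the `(NH_n, NH_n)`-bimodule
`M := NH_{n+1} ⊗_{NH_n ⊗ k[t]} (NH_n ⊗_k k₀)`, where `NH_{n+1}` is a right
`(NH_n ⊗ k[t])`-module via `φ` and in `NH_n ⊗_k k₀` the algebra `NH_n` acts by left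
multiplication while `t` acts by `0` (i.e. `p ∈ k[t]` acts by `p(0)`). -/
noncomputable def relM (φ : NH k n ⊗[k] Polynomial k →ₐ[k] NH k (n + 1)) :
    Submodule k (NH k (n + 1) ⊗[k] (NH k n ⊗[k] k)) :=
  Submodule.span k {z | ∃ (v : NH k (n + 1)) (a : NH k n) (p : Polynomial k)
      (w : NH k n) (c : k),
    z = (v * φ (a ⊗ₜ[k] p)) ⊗ₜ[k] (w ⊗ₜ[k] c)
      - v ⊗ₜ[k] ((a * w) ⊗ₜ[k] (Polynomial.eval 0 p * c))}

/-- The balancing relations defining the `(NH_n, NH_n)`-bimodule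
`N := NH_n ⊗_{NH_{n-1} ⊗ k[t]} (NH_n ⊗_k k₀)`, where the left factor `NH_n` is a right
`(NH_{n-1} ⊗ k[t])`-module via `φ'`, and in the right factor `NH_{n-1}` acts on `NH_n`
by left multiplication through the first-`(n-1)`-strands embedding `ι'` while `t` acts
by `0`. -/
noncomputable def relN (φ' : NH k (n - 1) ⊗[k] Polynomial k →ₐ[k] NH k n)
    (ι' : NH k (n - 1) →ₐ[k] NH k n) :
    Submodule k (NH k n ⊗[k] (NH k n ⊗[k] k)) :=
  Submodule.span k {z | ∃ (v : NH k n) (a : NH k (n - 1)) (p : Polynomial k)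
      (w : NH k n) (c : k),
    z = (v * φ' (a ⊗ₜ[k] p)) ⊗ₜ[k] (w ⊗ₜ[k] c)
      - v ⊗ₜ[k] ((ι' a * w) ⊗ₜ[k] (Polynomial.eval 0 p * c))}

/-! ## Families satisfying the nilHecke relations -/

/-- The first `N` members of `X` and the first `N - 1` members of `D` satisfy the nilHecke
relations on `N` strands. -/
structure NilHeckeFamily {A : Type*} [Ring A] (N : ℕ) (X D : ℕ → A) : Prop where
  xcomm : ∀ i j, i < N → j < N → X i * X j = X j * X i
  dsq : ∀ i, i + 1 < N → D i * D i = 0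
  braid : ∀ i, i + 2 < N → D i * D (i + 1) * D i = D (i + 1) * D i * D (i + 1)
  ddfar : ∀ i j, i + 1 < j → j + 1 < N → D i * D j = D j * D i
  xdfar : ∀ i j, i < N → j + 1 < N → (i + 1 < j ∨ j + 1 < i) → X i * D j = D j * X i
  xd : ∀ i, i + 1 < N → X i * D i = D i * X (i + 1) + 1
  dx : ∀ i, i + 1 < N → D i * X i = X (i + 1) * D i + 1

/-- The commutation of `x_i` with `∂_{i+1}` follows from the other nilHecke relations. -/
theorem NilHeckeFamily.xd_succ {A : Type*} [Ring A] {N : ℕ} {X D : ℕ → A}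
    (h : NilHeckeFamily N X D) (i : ℕ) (hi : i + 2 < N) :
    X i * D (i + 1) = D (i + 1) * X i := by
  have e1 := h.xd i (by omega)
  have e2 := h.xd (i + 1) (by omega)
  have f1 := h.dx i (by omega)
  have f2 := h.dx (i + 1) (by omega)
  have d1 := h.dsq i (by omega)
  have d2 := h.dsq (i + 1) (by omega)
  have b := h.braid i hi
  have c02 := h.xcomm i (i + 2) (by omega) (by omega)
  have c01 := h.xcomm i (i + 1) (by omega) (by omega)
  have far := h.xdfar (i + 2) i (by omega) (by omega) (by omega)
  simp only [show i + 1 + 1 = i + 2 by rfl] at e2 f2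
  generalize X i = x0 at *
  generalize X (i + 1) = x1 at *
  generalize X (i + 2) = x2 at *
  generalize D i = p at *
  generalize D (i + 1) = q at *
  obtain ⟨c, hc⟩ : ∃ c, c = x0 * q - q * x0 := ⟨_, rfl⟩
  have hx0q : x0 * q = q * x0 + c := by rw [hc]; abel
  have x2c : x2 * c = c * x1 := by
    have f2' : x2 * q = q * x1 - 1 := by rw [f2]; abel
    calc x2 * c = x0 * (x2 * q) - (x2 * q) * x0 := by
          rw [hc, mul_sub, ← mul_assoc, ← mul_assoc, ← mul_assoc, c02]
      _ = x0 * q * x1 - q * (x0 * x1) := by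
          rw [f2', c01]; noncomm_ring
      _ = c * x1 := by rw [hc]; noncomm_ring
  have x1c : x1 * c = c * x2 := by
    calc x1 * c = x0 * (x1 * q) - (x1 * q) * x0 := by
          rw [hc, mul_sub, ← mul_assoc, ← mul_assoc, ← mul_assoc, c01]
      _ = x0 * q * x2 - q * (x0 * x2) := by
          rw [e2, c02]; noncomm_ring
      _ = c * x2 := by rw [hc]; noncomm_ring
  have cpq : c * p * q = 0 := by
    have l : x0 * (p * q * p) = q * p + p * q * p * x2 := by
      calc x0 * (p * q * p) = (x0 * p) * q * p := by noncomm_ring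
        _ = p * (x1 * q) * p + q * p := by rw [e1]; noncomm_ring
        _ = p * q * (x2 * p) + p * p + q * p := by rw [e2]; noncomm_ring
        _ = _ := by rw [far, d1]; noncomm_ring
    have r : x0 * (q * p * q) = q * p + q * p * q * x2 + c * p * q := by
      calc x0 * (q * p * q) = (x0 * q) * p * q := by noncomm_ring
        _ = q * (x0 * p) * q + c * p * q := by rw [hx0q]; noncomm_ring
        _ = q * p * (x1 * q) + q * q + c * p * q := by rw [e1]; noncomm_ring
        _ = _ := by rw [e2, d2]; noncomm_ring
    rw [b] at l
    rw [l] at r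
    simpa using r
  have cp : c * p = 0 := by
    have : c * p * q * x1 = c * p + x1 * (c * p * q) := by
      calc c * p * q * x1 = c * p * (q * x1) := by noncomm_ring
        _ = c * (p * x2) * q + c * p := by rw [f2]; noncomm_ring
        _ = (c * x2) * p * q + c * p := by rw [← far]; noncomm_ring
        _ = _ := by rw [← x1c]; noncomm_ring
    simpa [cpq] using this.symm
  have c0 : c = 0 := by
    have : c * p * x0 = c + x2 * (c * p) := by
      calc c * p * x0 = c * (p * x0) := by noncomm_ring
        _ = (c * x1) * p + c := by rw [f1]; noncomm_ring
        _ = _ := by rw [← x2c]; noncomm_ring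
    simpa [cp] using this.symm
  rw [hx0q, c0, add_zero]

theorem NilHeckeFamily.xd_comm {A : Type*} [Ring A] {N : ℕ} {X D : ℕ → A}
    (h : NilHeckeFamily N X D) (i j : ℕ) (hi : i < N) (hj : j + 1 < N) (hij : i < j ∨ j + 1 < i) :
    X i * D j = D j * X i := by
  by_cases h1 : i + 1 = j
  · subst h1
    exact h.xd_succ i hj
  · exact h.xdfar i j hi hj (by omega)

/-- The algebra homomorphism out of the nilHecke algebra given by a nilHecke family. -/
noncomputable def NilHeckeFamily.lift {A : Type*} [Ring A] [Algebra k A] {N : ℕ} {X D : ℕ → A}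
    (h : NilHeckeFamily N X D) : NH k N →ₐ[k] A :=
  RingQuot.liftAlgHom k ⟨FreeAlgebra.lift k (Sum.elim (fun i => X i) (fun j => D j.1)), by
    intro x y hxy
    induction hxy with
    | xcomm i j => simpa using h.xcomm i j i.2 j.2
    | dsq i => simpa using h.dsq i.1 i.2
    | braid i j hij =>
      have := h.braid i.1 (by have := j.2; omega)
      simpa [hij] using this
    | ddfar i j hij =>
      rcases hij with hij | hij
      · simpa using h.ddfar i.1 j.1 hij j.2
      · simpa using (h.ddfar j.1 i.1 hij i.2).symm
    | xdfar i j hij => simpa using h.xdfar i j.1 i.2 j.2 hij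
    | xd i => simp [h.xd i.1 i.2]
    | dx i => simp [h.dx i.1 i.2]⟩

/-- The generator `x_i` for a natural number index, zero when out of range. -/
noncomputable def nhX (N i : ℕ) : NH k N := if h : i < N then xg k N ⟨i, h⟩ else 0

/-- The generator `∂_i` for a natural number index, zero when out of range. -/
noncomputable def nhD (N i : ℕ) : NH k N :=
  if h : i + 1 < N then dg k N ⟨⟨i, by omega⟩, h⟩ else 0

theorem nhX_of_lt {N i : ℕ} (h : i < N) :
    nhX k N i = RingQuot.mkAlgHom k (NHRel k N) (NHx k N ⟨i, h⟩) :=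
  dif_pos h

theorem nhD_of_lt {N i : ℕ} (h : i + 1 < N) :
    nhD k N i = RingQuot.mkAlgHom k (NHRel k N) (NHd k N ⟨⟨i, by omega⟩, h⟩) :=
  dif_pos h

theorem xg_eq_nhX {N : ℕ} (i : Fin N) : xg k N i = nhX k N i := by simp [nhX]

theorem dg_eq_nhD {N : ℕ} (j : DIdx N) : dg k N j = nhD k N j.1 := by
  have := j.2
  simp [nhD, this]

theorem nh_rel {N : ℕ} {a b : FreeAlgebra k (NHGen N)} (h : NHRel k N a b) :
    (RingQuot.mkAlgHom k (NHRel k N) a : NH k N) = RingQuot.mkAlgHom k (NHRel k N) b :=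
  RingQuot.mkAlgHom_rel k h

theorem nilHeckeFamily_nh (N : ℕ) : NilHeckeFamily N (nhX k N) (nhD k N) := by
  constructor
  · intro i j hi hj
    have := nh_rel k (NHRel.xcomm (k := k) (N := N) ⟨i, hi⟩ ⟨j, hj⟩)
    rw [nhX_of_lt k hi, nhX_of_lt k hj]
    exact (map_mul _ _ _).symm.trans (this.trans (map_mul _ _ _))
  · intro i hi
    have := nh_rel k (NHRel.dsq (k := k) (N := N) ⟨⟨i, by omega⟩, hi⟩)
    rw [nhD_of_lt k hi]
    exact (map_mul _ _ _).symm.trans (this.trans (map_zero _))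
  · intro i hi
    have := nh_rel k (NHRel.braid (k := k) (N := N) ⟨⟨i, by omega⟩, show i + 1 < N by omega⟩
      ⟨⟨i + 1, by omega⟩, hi⟩ rfl)
    simp only [map_mul] at this
    have h1 : i + 1 < N := by omega
    have h2 : i + 1 + 1 < N := hi
    rw [nhD_of_lt k h1, nhD_of_lt k h2]
    exact this
  · intro i j hij hj
    have := nh_rel k (NHRel.ddfar (k := k) (N := N) ⟨⟨i, by omega⟩, show i + 1 < N by omega⟩
      ⟨⟨j, by omega⟩, hj⟩ (Or.inl hij))
    simp only [map_mul] at this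
    have h1 : i + 1 < N := by omega
    rw [nhD_of_lt k h1, nhD_of_lt k hj]
    exact this
  · intro i j hi hj hij
    have := nh_rel k (NHRel.xdfar (k := k) (N := N) ⟨i, hi⟩ ⟨⟨j, by omega⟩, hj⟩ hij)
    simp only [map_mul] at this
    rw [nhX_of_lt k hi, nhD_of_lt k hj]
    exact this
  · intro i hi
    have := nh_rel k (NHRel.xd (k := k) (N := N) ⟨⟨i, by omega⟩, hi⟩)
    simp only [map_mul, map_sub, map_one] at this
    have h1 : i < N := by omega
    rw [nhX_of_lt k h1, nhX_of_lt k hi, nhD_of_lt k hi]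
    exact (sub_eq_iff_eq_add'.mp this)
  · intro i hi
    have := nh_rel k (NHRel.dx (k := k) (N := N) ⟨⟨i, by omega⟩, hi⟩)
    simp only [map_mul, map_sub, map_one] at this
    have h1 : i < N := by omega
    rw [nhX_of_lt k h1, nhX_of_lt k hi, nhD_of_lt k hi]
    exact (sub_eq_iff_eq_add'.mp this)

theorem NilHeckeFamily.lift_nhX {A : Type*} [Ring A] [Algebra k A] {N : ℕ} {X D : ℕ → A}
    (h : NilHeckeFamily N X D) {i : ℕ} (hi : i < N) : h.lift k (nhX k N i) = X i := by
  rw [nhX_of_lt k hi]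
  refine (RingQuot.liftAlgHom_mkAlgHom_apply (S := k) (B := A) _ _ _).trans ?_
  simp

theorem NilHeckeFamily.lift_nhD {A : Type*} [Ring A] [Algebra k A] {N : ℕ} {X D : ℕ → A}
    (h : NilHeckeFamily N X D) {i : ℕ} (hi : i + 1 < N) : h.lift k (nhD k N i) = D i := by
  rw [nhD_of_lt k hi]
  refine (RingQuot.liftAlgHom_mkAlgHom_apply (S := k) (B := A) _ _ _).trans ?_
  simp

/-- A subspace of the nilHecke algebra that contains `1` and is stable under left multiplication
by the generators is everything. -/
theorem nh_eq_top_of_left_stable {N : ℕ} (S : Submodule k (NH k N)) (h1 : 1 ∈ S)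
    (hX : ∀ i < N, ∀ s ∈ S, nhX k N i * s ∈ S)
    (hD : ∀ i, i + 1 < N → ∀ s ∈ S, nhD k N i * s ∈ S) : S = ⊤ := by
  rw [eq_top_iff]
  rintro v -
  obtain ⟨a, ha⟩ := RingQuot.mkAlgHom_surjective k (NHRel k N) v
  let π : FreeAlgebra k (NHGen N) →ₐ[k] NH k N := RingQuot.mkAlgHom k (NHRel k N)
  suffices h : ∀ s ∈ S, π a * s ∈ S by
    have := h 1 h1
    rw [mul_one] at this
    exact ha ▸ this
  clear ha
  induction a using FreeAlgebra.induction with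
  | grade0 r =>
    intro s hs
    rw [AlgHom.commutes, ← Algebra.smul_def]
    exact S.smul_mem r hs
  | grade1 x =>
    intro s hs
    rcases x with i | j
    · have := hX i i.2 s hs
      rwa [← xg_eq_nhX] at this
    · have := hD j.1 j.2 s hs
      rwa [← dg_eq_nhD] at this
  | mul a b ha hb =>
    intro s hs
    rw [map_mul, mul_assoc]
    exact ha _ (hb _ hs)
  | add a b ha hb =>
    intro s hs
    rw [map_add, add_mul]
    exact S.add_mem (ha _ hs) (hb _ hs)

theorem nh_algHom_ext {A : Type*} [Ring A] [Algebra k A] {N : ℕ} {f g : NH k N →ₐ[k] A}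
    (hX : ∀ i < N, f (nhX k N i) = g (nhX k N i))
    (hD : ∀ i, i + 1 < N → f (nhD k N i) = g (nhD k N i)) : f = g := by
  have : LinearMap.eqLocus f.toLinearMap g.toLinearMap = ⊤ := by
    refine nh_eq_top_of_left_stable k _ (by simp) ?_ ?_
    · intro i hi s hs
      simp only [LinearMap.mem_eqLocus, AlgHom.toLinearMap_apply, map_mul] at hs ⊢
      rw [hs, hX i hi]
    · intro i hi s hs
      simp only [LinearMap.mem_eqLocus, AlgHom.toLinearMap_apply, map_mul] at hs ⊢
      rw [hs, hD i hi]
  ext a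
  have ha : a ∈ LinearMap.eqLocus f.toLinearMap g.toLinearMap := this ▸ Submodule.mem_top
  exact ha

theorem NilHeckeFamily.mono {A : Type*} [Ring A] {M N : ℕ} {X D : ℕ → A}
    (h : NilHeckeFamily N X D) (hMN : M ≤ N) : NilHeckeFamily M X D where
  xcomm i j hi hj := h.xcomm i j (by omega) (by omega)
  dsq i hi := h.dsq i (by omega)
  braid i hi := h.braid i (by omega)
  ddfar i j hij hj := h.ddfar i j hij (by omega)
  xdfar i j hi hj hij := h.xdfar i j (by omega) (by omega) hij
  xd i hi := h.xd i (by omega)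
  dx i hi := h.dx i (by omega)

/-- The embedding of the nilHecke algebra onto the first `n` of `n + 1` strands. -/
noncomputable def nhEmb (n : ℕ) : NH k n →ₐ[k] NH k (n + 1) :=
  ((nilHeckeFamily_nh k (n + 1)).mono n.le_succ).lift k

theorem nhEmb_nhX {n i : ℕ} (hi : i < n) : nhEmb k n (nhX k n i) = nhX k (n + 1) i :=
  NilHeckeFamily.lift_nhX k _ hi

theorem nhEmb_nhD {n i : ℕ} (hi : i + 1 < n) : nhEmb k n (nhD k n i) = nhD k (n + 1) i :=
  NilHeckeFamily.lift_nhD k _ hi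

/-- An element commuting with the generators on the first `n` strands commutes with the image
of the embedding. -/
theorem nhEmb_commute {A : Type*} [Ring A] [Algebra k A] {n : ℕ} (f : NH k n →ₐ[k] A) (z : A)
    (hX : ∀ i < n, Commute (f (nhX k n i)) z)
    (hD : ∀ i, i + 1 < n → Commute (f (nhD k n i)) z) (a : NH k n) : Commute (f a) z := by
  have : LinearMap.eqLocus ((LinearMap.mulRight k z).comp f.toLinearMap)
      ((LinearMap.mulLeft k z).comp f.toLinearMap) = ⊤ := by
    refine nh_eq_top_of_left_stable k _ (by simp) ?_ ?_
    · intro i hi s hs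
      simp only [LinearMap.mem_eqLocus, LinearMap.comp_apply, AlgHom.toLinearMap_apply, map_mul,
        LinearMap.mulRight_apply, LinearMap.mulLeft_apply] at hs ⊢
      rw [mul_assoc, hs, ← mul_assoc, (hX i hi).eq, mul_assoc]
    · intro i hi s hs
      simp only [LinearMap.mem_eqLocus, LinearMap.comp_apply, AlgHom.toLinearMap_apply, map_mul,
        LinearMap.mulRight_apply, LinearMap.mulLeft_apply] at hs ⊢
      rw [mul_assoc, hs, ← mul_assoc, (hD i hi).eq, mul_assoc]
  have ha : a ∈ LinearMap.eqLocus ((LinearMap.mulRight k z).comp f.toLinearMap)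
      ((LinearMap.mulLeft k z).comp f.toLinearMap) := this ▸ Submodule.mem_top
  exact ha

theorem nhEmb_commute_nhX (n : ℕ) (a : NH k n) :
    Commute (nhEmb k n a) (nhX k (n + 1) n) := by
  refine nhEmb_commute k _ _ (fun i hi => ?_) (fun i hi => ?_) a
  · rw [nhEmb_nhX k hi]
    exact (nilHeckeFamily_nh k (n + 1)).xcomm _ _ (by omega) (by omega)
  · rw [nhEmb_nhD k hi]
    exact ((nilHeckeFamily_nh k (n + 1)).xd_comm _ _ (by omega) (by omega) (by omega)).symm

theorem nhEmb_nhEmb_commute_nhD (n : ℕ) (a : NH k n) :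
    Commute (nhEmb k (n + 1) (nhEmb k n a)) (nhD k (n + 2) n) := by
  refine nhEmb_commute k ((nhEmb k (n + 1)).comp (nhEmb k n)) _ (fun i hi => ?_)
    (fun i hi => ?_) a
  · rw [AlgHom.comp_apply, nhEmb_nhX k hi, nhEmb_nhX k (by omega)]
    exact (nilHeckeFamily_nh k (n + 2)).xd_comm _ _ (by omega) (by omega) (by omega)
  · rw [AlgHom.comp_apply, nhEmb_nhD k hi, nhEmb_nhD k (by omega)]
    exact (nilHeckeFamily_nh k (n + 2)).ddfar _ _ (by omega) (by omega)

/-! ## Divided differences on polynomials -/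

/-- The exchange of the variables `X i` and `X (i + 1)`. -/
noncomputable def varSwap (i : ℕ) : MvPolynomial ℕ k →ₐ[k] MvPolynomial ℕ k :=
  MvPolynomial.rename (Equiv.swap i (i + 1))

@[simp] theorem varSwap_X_self (i : ℕ) :
    varSwap k i (MvPolynomial.X i) = MvPolynomial.X (i + 1) := by simp [varSwap]

@[simp] theorem varSwap_X_succ (i : ℕ) :
    varSwap k i (MvPolynomial.X (i + 1)) = MvPolynomial.X i := by simp [varSwap]

theorem varSwap_X_of_ne {i j : ℕ} (h : j ≠ i) (h' : j ≠ i + 1) :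
    varSwap k i (MvPolynomial.X j) = MvPolynomial.X j := by
  simp [varSwap, Equiv.swap_apply_of_ne_of_ne h h']

@[simp] theorem varSwap_varSwap (i : ℕ) (f : MvPolynomial ℕ k) :
    varSwap k i (varSwap k i f) = f := by
  simp only [varSwap, MvPolynomial.rename_rename]
  have : (Equiv.swap i (i + 1) : ℕ → ℕ) ∘ Equiv.swap i (i + 1) = id := by ext; simp
  rw [this, MvPolynomial.rename_id_apply]

theorem varSwap_comm {i j : ℕ} (h : i + 1 < j) (f : MvPolynomial ℕ k) :
    varSwap k i (varSwap k j f) = varSwap k j (varSwap k i f) := by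
  simp only [varSwap, MvPolynomial.rename_rename]
  congr 1
  congr 1
  ext a
  simp only [Function.comp_apply, Equiv.swap_apply_def]
  grind

theorem varSwap_braid (i : ℕ) (f : MvPolynomial ℕ k) :
    varSwap k i (varSwap k (i + 1) (varSwap k i f)) =
      varSwap k (i + 1) (varSwap k i (varSwap k (i + 1) f)) := by
  simp only [varSwap, MvPolynomial.rename_rename]
  congr 1
  congr 1
  ext a
  simp only [Function.comp_apply, Equiv.swap_apply_def]
  grind

theorem X_sub_X_dvd_sub_varSwap (i : ℕ) (f : MvPolynomial ℕ k) :
    (MvPolynomial.X i - MvPolynomial.X (i + 1) : MvPolynomial ℕ k) ∣ f - varSwap k i f := by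
  induction f using MvPolynomial.induction_on with
  | C a => simp [varSwap]
  | add p q hp hq =>
    rw [map_add, add_sub_add_comm]
    exact dvd_add hp hq
  | mul_X p j hp =>
    have hX : (MvPolynomial.X i - MvPolynomial.X (i + 1) : MvPolynomial ℕ k) ∣
        MvPolynomial.X j - varSwap k i (MvPolynomial.X j) := by
      by_cases h : j = i
      · subst h; simp
      · by_cases h' : j = i + 1
        · subst h'
          rw [varSwap_X_succ]
          exact dvd_sub_comm.1 dvd_rfl
        · simp [varSwap_X_of_ne k h h']
    have : p * MvPolynomial.X j - varSwap k i (p * MvPolynomial.X j) =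
        (p - varSwap k i p) * MvPolynomial.X j +
          varSwap k i p * (MvPolynomial.X j - varSwap k i (MvPolynomial.X j)) := by
      rw [map_mul]; ring
    rw [this]
    exact dvd_add (hp.mul_right _) (hX.mul_left _)

theorem X_sub_X_ne_zero {i j : ℕ} (h : i ≠ j) :
    (MvPolynomial.X i - MvPolynomial.X j : MvPolynomial ℕ k) ≠ 0 :=
  sub_ne_zero.2 fun e => h (MvPolynomial.X_injective e)

/-- The `i`-th divided difference operator. -/
noncomputable def dividedDiff (i : ℕ) : MvPolynomial ℕ k →ₗ[k] MvPolynomial ℕ k where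
  toFun f := (X_sub_X_dvd_sub_varSwap k i f).choose
  map_add' f g := by
    apply mul_left_cancel₀ (X_sub_X_ne_zero k i.succ_ne_self.symm)
    rw [mul_add, ← (X_sub_X_dvd_sub_varSwap k i f).choose_spec,
      ← (X_sub_X_dvd_sub_varSwap k i g).choose_spec,
      ← (X_sub_X_dvd_sub_varSwap k i (f + g)).choose_spec, map_add]
    ring
  map_smul' c f := by
    apply mul_left_cancel₀ (X_sub_X_ne_zero k i.succ_ne_self.symm)
    rw [RingHom.id_apply, mul_smul_comm, ← (X_sub_X_dvd_sub_varSwap k i f).choose_spec,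
      ← (X_sub_X_dvd_sub_varSwap k i (c • f)).choose_spec, map_smul, smul_sub]

theorem dividedDiff_spec (i : ℕ) (f : MvPolynomial ℕ k) :
    (MvPolynomial.X i - MvPolynomial.X (i + 1)) * dividedDiff k i f = f - varSwap k i f :=
  (X_sub_X_dvd_sub_varSwap k i f).choose_spec.symm

theorem dividedDiff_eq_of_mul {i : ℕ} {f g : MvPolynomial ℕ k}
    (h : (MvPolynomial.X i - MvPolynomial.X (i + 1)) * g = f - varSwap k i f) :
    dividedDiff k i f = g :=
  mul_left_cancel₀ (X_sub_X_ne_zero k i.succ_ne_self.symm) ((dividedDiff_spec k i f).trans h.symm)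

theorem dividedDiff_X_mul_self (i : ℕ) (f : MvPolynomial ℕ k) :
    dividedDiff k i (MvPolynomial.X i * f) =
      MvPolynomial.X (i + 1) * dividedDiff k i f + f := by
  apply dividedDiff_eq_of_mul
  rw [map_mul, varSwap_X_self]
  linear_combination MvPolynomial.X (i + 1) * dividedDiff_spec k i f

theorem dividedDiff_X_mul_succ (i : ℕ) (f : MvPolynomial ℕ k) :
    dividedDiff k i (MvPolynomial.X (i + 1) * f) =
      MvPolynomial.X i * dividedDiff k i f - f := by
  apply dividedDiff_eq_of_mul
  rw [map_mul, varSwap_X_succ]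
  linear_combination MvPolynomial.X i * dividedDiff_spec k i f

theorem dividedDiff_X_mul_succ' (i : ℕ) (f : MvPolynomial ℕ k) :
    dividedDiff k i (MvPolynomial.X (i + 1) * f) =
      MvPolynomial.X (i + 1) * dividedDiff k i f - varSwap k i f := by
  rw [dividedDiff_X_mul_succ]
  linear_combination dividedDiff_spec k i f

theorem dividedDiff_X_mul_of_ne {i j : ℕ} (h : j ≠ i) (h' : j ≠ i + 1) (f : MvPolynomial ℕ k) :
    dividedDiff k i (MvPolynomial.X j * f) = MvPolynomial.X j * dividedDiff k i f := by
  apply dividedDiff_eq_of_mul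
  rw [map_mul, varSwap_X_of_ne k h h']
  linear_combination MvPolynomial.X j * dividedDiff_spec k i f

theorem varSwap_dividedDiff_self (i : ℕ) (f : MvPolynomial ℕ k) :
    varSwap k i (dividedDiff k i f) = dividedDiff k i f := by
  apply mul_left_cancel₀ (X_sub_X_ne_zero k i.succ_ne_self.symm)
  have h := congrArg (varSwap k i) (dividedDiff_spec k i f)
  simp only [map_mul, map_sub, varSwap_X_self, varSwap_X_succ, varSwap_varSwap] at h
  linear_combination -h - dividedDiff_spec k i f

theorem dividedDiff_dividedDiff_self (i : ℕ) (f : MvPolynomial ℕ k) :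
    dividedDiff k i (dividedDiff k i f) = 0 := by
  apply dividedDiff_eq_of_mul
  rw [varSwap_dividedDiff_self, mul_zero, sub_self]

theorem varSwap_dividedDiff_comm {i j : ℕ} (h : i + 1 < j ∨ j + 1 < i) (f : MvPolynomial ℕ k) :
    varSwap k i (dividedDiff k j f) = dividedDiff k j (varSwap k i f) := by
  symm
  apply dividedDiff_eq_of_mul
  have hs := congrArg (varSwap k i) (dividedDiff_spec k j f)
  simp only [map_mul, map_sub] at hs
  rw [varSwap_X_of_ne k (by omega) (by omega), varSwap_X_of_ne k (by omega) (by omega)] at hs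
  rw [hs]
  rcases h with h | h
  · rw [varSwap_comm k h]
  · rw [varSwap_comm k h]

theorem dividedDiff_comm {i j : ℕ} (h : i + 1 < j) (f : MvPolynomial ℕ k) :
    dividedDiff k i (dividedDiff k j f) = dividedDiff k j (dividedDiff k i f) := by
  apply dividedDiff_eq_of_mul
  rw [varSwap_dividedDiff_comm k (Or.inl h), ← map_sub, ← dividedDiff_spec, sub_mul, sub_mul,
    map_sub, dividedDiff_X_mul_of_ne k (by omega) (by omega),
    dividedDiff_X_mul_of_ne k (by omega) (by omega)]

theorem dividedDiff_braid_left (i : ℕ) (f : MvPolynomial ℕ k) :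
    (MvPolynomial.X i - MvPolynomial.X (i + 1)) * (MvPolynomial.X (i + 1) - MvPolynomial.X (i + 2))
      * (MvPolynomial.X i - MvPolynomial.X (i + 2)) *
      dividedDiff k i (dividedDiff k (i + 1) (dividedDiff k i f)) =
    f - varSwap k i f - varSwap k (i + 1) f + varSwap k (i + 1) (varSwap k i f) +
      varSwap k i (varSwap k (i + 1) f) - varSwap k i (varSwap k (i + 1) (varSwap k i f)) := by
  have hu := dividedDiff_spec k i f
  generalize dividedDiff k i f = u at hu ⊢
  have hv := dividedDiff_spec k (i + 1) u
  generalize dividedDiff k (i + 1) u = v at hv ⊢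
  have hw := dividedDiff_spec k i v
  generalize dividedDiff k i v = w at hw ⊢
  simp only [show i + 1 + 1 = i + 2 by rfl] at hv
  have e0 : varSwap k (i + 1) (MvPolynomial.X i) = MvPolynomial.X i :=
    varSwap_X_of_ne k (by omega) (by omega)
  have e1 : varSwap k (i + 1) (MvPolynomial.X (i + 1)) = MvPolynomial.X (i + 2) :=
    varSwap_X_self k (i + 1)
  have e2 : varSwap k i (MvPolynomial.X (i + 2)) = MvPolynomial.X (i + 2) :=
    varSwap_X_of_ne k (by omega) (by omega)
  have hu1 := congrArg (varSwap k (i + 1)) hu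
  simp only [map_mul, map_sub, e0, e1] at hu1
  have hv' : (MvPolynomial.X i - MvPolynomial.X (i + 1)) *
      (MvPolynomial.X i - MvPolynomial.X (i + 2)) *
      ((MvPolynomial.X (i + 1) - MvPolynomial.X (i + 2)) * v) =
      (MvPolynomial.X i - MvPolynomial.X (i + 2)) * (f - varSwap k i f) -
      (MvPolynomial.X i - MvPolynomial.X (i + 1)) *
        (varSwap k (i + 1) f - varSwap k (i + 1) (varSwap k i f)) := by
    rw [hv]
    linear_combination (MvPolynomial.X i - MvPolynomial.X (i + 2)) * hu -
      (MvPolynomial.X i - MvPolynomial.X (i + 1)) * hu1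
  have hv0 := congrArg (varSwap k i) hv'
  simp only [map_mul, map_sub, e2, varSwap_X_self, varSwap_X_succ, varSwap_varSwap] at hv0
  apply mul_left_cancel₀ (X_sub_X_ne_zero k i.succ_ne_self.symm)
  linear_combination hv' + hv0 + (MvPolynomial.X i - MvPolynomial.X (i + 1)) *
    (MvPolynomial.X (i + 1) - MvPolynomial.X (i + 2)) *
    (MvPolynomial.X i - MvPolynomial.X (i + 2)) * hw

theorem dividedDiff_braid_right (i : ℕ) (f : MvPolynomial ℕ k) :
    (MvPolynomial.X i - MvPolynomial.X (i + 1)) * (MvPolynomial.X (i + 1) - MvPolynomial.X (i + 2))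
      * (MvPolynomial.X i - MvPolynomial.X (i + 2)) *
      dividedDiff k (i + 1) (dividedDiff k i (dividedDiff k (i + 1) f)) =
    f - varSwap k i f - varSwap k (i + 1) f + varSwap k (i + 1) (varSwap k i f) +
      varSwap k i (varSwap k (i + 1) f) - varSwap k i (varSwap k (i + 1) (varSwap k i f)) := by
  rw [varSwap_braid]
  have hu := dividedDiff_spec k (i + 1) f
  generalize dividedDiff k (i + 1) f = u at hu ⊢
  have hv := dividedDiff_spec k i u
  generalize dividedDiff k i u = v at hv ⊢
  have hw := dividedDiff_spec k (i + 1) v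
  generalize dividedDiff k (i + 1) v = w at hw ⊢
  simp only [show i + 1 + 1 = i + 2 by rfl] at hu hw
  have e0 : varSwap k (i + 1) (MvPolynomial.X i) = MvPolynomial.X i :=
    varSwap_X_of_ne k (by omega) (by omega)
  have e1 : varSwap k (i + 1) (MvPolynomial.X (i + 1)) = MvPolynomial.X (i + 2) :=
    varSwap_X_self k (i + 1)
  have e1' : varSwap k (i + 1) (MvPolynomial.X (i + 2)) = MvPolynomial.X (i + 1) :=
    varSwap_X_succ k (i + 1)
  have e2 : varSwap k i (MvPolynomial.X (i + 2)) = MvPolynomial.X (i + 2) :=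
    varSwap_X_of_ne k (by omega) (by omega)
  have hu1 := congrArg (varSwap k i) hu
  simp only [map_mul, map_sub, e2, varSwap_X_succ] at hu1
  have hv' : (MvPolynomial.X (i + 1) - MvPolynomial.X (i + 2)) *
      (MvPolynomial.X i - MvPolynomial.X (i + 2)) *
      ((MvPolynomial.X i - MvPolynomial.X (i + 1)) * v) =
      (MvPolynomial.X i - MvPolynomial.X (i + 2)) * (f - varSwap k (i + 1) f) -
      (MvPolynomial.X (i + 1) - MvPolynomial.X (i + 2)) *
        (varSwap k i f - varSwap k i (varSwap k (i + 1) f)) := by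
    rw [hv]
    linear_combination (MvPolynomial.X i - MvPolynomial.X (i + 2)) * hu -
      (MvPolynomial.X (i + 1) - MvPolynomial.X (i + 2)) * hu1
  have hv0 := congrArg (varSwap k (i + 1)) hv'
  simp only [map_mul, map_sub, e0, e1, e1', varSwap_varSwap] at hv0
  apply mul_left_cancel₀ (X_sub_X_ne_zero k (show i + 1 ≠ i + 2 by omega))
  linear_combination hv' + hv0 + (MvPolynomial.X i - MvPolynomial.X (i + 1)) *
    (MvPolynomial.X (i + 1) - MvPolynomial.X (i + 2)) *
    (MvPolynomial.X i - MvPolynomial.X (i + 2)) * hw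

theorem dividedDiff_braid (i : ℕ) (f : MvPolynomial ℕ k) :
    dividedDiff k i (dividedDiff k (i + 1) (dividedDiff k i f)) =
      dividedDiff k (i + 1) (dividedDiff k i (dividedDiff k (i + 1) f)) := by
  refine mul_left_cancel₀ ?_
    ((dividedDiff_braid_left k i f).trans (dividedDiff_braid_right k i f).symm)
  exact mul_ne_zero (mul_ne_zero (X_sub_X_ne_zero k (by omega)) (X_sub_X_ne_zero k (by omega)))
    (X_sub_X_ne_zero k (by omega))

/-- Multiplication by a variable, in the opposite of the endomorphism algebra. -/
noncomputable def mulXOp (i : ℕ) : (Module.End k (MvPolynomial ℕ k))ᵐᵒᵖ :=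
  MulOpposite.op (LinearMap.mulLeft k (MvPolynomial.X i))

/-- A divided difference, in the opposite of the endomorphism algebra. -/
noncomputable def dividedDiffOp (i : ℕ) : (Module.End k (MvPolynomial ℕ k))ᵐᵒᵖ :=
  MulOpposite.op (dividedDiff k i)

theorem nilHeckeFamily_op (N : ℕ) : NilHeckeFamily N (mulXOp k) (dividedDiffOp k) := by
  constructor <;> intro i <;> intros <;> apply MulOpposite.unop_injective <;>
    apply LinearMap.ext <;> intro f <;>
    simp only [mulXOp, dividedDiffOp, MulOpposite.unop_mul, MulOpposite.unop_op,
      Module.End.mul_apply, LinearMap.mulLeft_apply, MulOpposite.unop_add, LinearMap.add_apply,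
      MulOpposite.unop_one, Module.End.one_apply, MulOpposite.unop_zero, LinearMap.zero_apply]
  · ring
  · exact dividedDiff_dividedDiff_self k i f
  · exact dividedDiff_braid k i f
  · exact (dividedDiff_comm k (by assumption) f).symm
  · exact dividedDiff_X_mul_of_ne k (by omega) (by omega) f
  · exact dividedDiff_X_mul_self k i f
  · rw [dividedDiff_X_mul_succ, sub_add_cancel]

/-- The right action of the nilHecke algebra on polynomials in infinitely many variables, in
which `x_i` acts by multiplication and `∂_i` by a divided difference. -/
noncomputable def nhRep (N : ℕ) : NH k N →ₐ[k] (Module.End k (MvPolynomial ℕ k))ᵐᵒᵖ :=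
  (nilHeckeFamily_op k N).lift k

/-- The result of acting by an element of the nilHecke algebra on a polynomial from the right. -/
noncomputable def nhAct {N : ℕ} (f : MvPolynomial ℕ k) (a : NH k N) : MvPolynomial ℕ k :=
  (nhRep k N a).unop f

theorem nhAct_mul {N : ℕ} (f : MvPolynomial ℕ k) (a b : NH k N) :
    nhAct k f (a * b) = nhAct k (nhAct k f a) b := by
  simp [nhAct]

theorem nhAct_add {N : ℕ} (f : MvPolynomial ℕ k) (a b : NH k N) :
    nhAct k f (a + b) = nhAct k f a + nhAct k f b := by
  simp [nhAct]

theorem nhAct_one {N : ℕ} (f : MvPolynomial ℕ k) : nhAct k f (1 : NH k N) = f := by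
  simp [nhAct]

theorem nhAct_zero {N : ℕ} (f : MvPolynomial ℕ k) : nhAct k f (0 : NH k N) = 0 := by
  simp [nhAct]

theorem zero_nhAct {N : ℕ} (a : NH k N) : nhAct k 0 a = 0 := by
  simp [nhAct]

theorem nhAct_smul {N : ℕ} (f : MvPolynomial ℕ k) (c : k) (a : NH k N) :
    nhAct k f (c • a) = c • nhAct k f a := by
  simp [nhAct]

theorem nhAct_sum {N : ℕ} {J : Type*} (s : Finset J) (f : MvPolynomial ℕ k) (a : J → NH k N) :
    nhAct k f (∑ j ∈ s, a j) = ∑ j ∈ s, nhAct k f (a j) := by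
  simp [nhAct]

theorem nhAct_nhX {N i : ℕ} (hi : i < N) (f : MvPolynomial ℕ k) :
    nhAct k f (nhX k N i) = MvPolynomial.X i * f := by
  simp only [nhAct, nhRep]
  rw [NilHeckeFamily.lift_nhX k _ hi]
  rfl

theorem nhAct_nhD {N i : ℕ} (hi : i + 1 < N) (f : MvPolynomial ℕ k) :
    nhAct k f (nhD k N i) = dividedDiff k i f := by
  simp only [nhAct, nhRep]
  rw [NilHeckeFamily.lift_nhD k _ hi]
  rfl

/-! ## The decomposition of the nilHecke algebra over the first strands -/

/-- The product `D j * D (j + 1) * ⋯ * D (j + l - 1)`. -/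
def consecProd {A : Type*} [Monoid A] (D : ℕ → A) : ℕ → ℕ → A
  | _, 0 => 1
  | j, l + 1 => D j * consecProd D (j + 1) l

theorem consecProd_succ_right {A : Type*} [Monoid A] (D : ℕ → A) (j l : ℕ) :
    consecProd D j (l + 1) = consecProd D j l * D (j + l) := by
  induction l generalizing j with
  | zero => simp [consecProd]
  | succ l ih =>
    rw [consecProd, ih, ← mul_assoc, show j + (l + 1) = j + 1 + l by omega]
    rfl

theorem map_consecProd {A B F : Type*} [Monoid A] [Monoid B] [FunLike F A B] [MonoidHomClass F A B]
    (φ : F) (D : ℕ → A) (D' : ℕ → B) (j l : ℕ)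
    (h : ∀ i, j ≤ i → i < j + l → φ (D i) = D' i) :
    φ (consecProd D j l) = consecProd D' j l := by
  induction l generalizing j with
  | zero => simp [consecProd]
  | succ l ih =>
    rw [consecProd, consecProd, map_mul, h j le_rfl (by omega),
      ih (j + 1) (fun i hi hi' => h i (by omega) (by omega))]

/-- The element `∂_j ∂_{j+1} ⋯ ∂_{n-1}` of the nilHecke algebra on `n + 1` strands, a minimal
coset representative. -/
noncomputable def cosetRep (n j : ℕ) : NH k (n + 1) := consecProd (nhD k (n + 1)) j (n - j)

theorem cosetRep_self (n : ℕ) : cosetRep k n n = 1 := by simp [cosetRep, consecProd]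

theorem cosetRep_of_lt {n j : ℕ} (h : j < n) :
    cosetRep k n j = nhD k (n + 1) j * cosetRep k n (j + 1) := by
  simp only [cosetRep]
  rw [show n - j = n - (j + 1) + 1 by omega, consecProd]

theorem cosetRep_succ {n j : ℕ} (h : j ≤ n) :
    cosetRep k (n + 1) j = nhEmb k (n + 1) (cosetRep k n j) * nhD k (n + 2) n := by
  simp only [cosetRep]
  rw [map_consecProd (nhEmb k (n + 1)) _ (nhD k (n + 2)) j (n - j)
    (fun i _ hi => nhEmb_nhD k (by omega)), show n + 1 - j = n - j + 1 by omega,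
    consecProd_succ_right, show j + (n - j) = n by omega]

theorem nhD_mul_cosetRep_of_lt {n i j : ℕ} (hij : i + 1 < j) (hj : j ≤ n) :
    nhD k (n + 1) i * cosetRep k n j = cosetRep k n j * nhD k (n + 1) i := by
  induction hj using Nat.decreasingInduction with
  | self => simp [cosetRep_self]
  | of_succ j hj ih =>
    rw [cosetRep_of_lt k hj, ← mul_assoc,
      (nilHeckeFamily_nh k (n + 1)).ddfar i j hij (by omega), mul_assoc, ih (by omega), mul_assoc]

theorem nhD_succ_mul_cosetRep {n i j : ℕ} (hij : j ≤ i) (hi : i + 1 < n) :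
    nhD k (n + 1) (i + 1) * cosetRep k n j = cosetRep k n j * nhD k (n + 1) i := by
  have hN := nilHeckeFamily_nh k (n + 1)
  induction hij using Nat.decreasingInduction with
  | self =>
    rw [cosetRep_of_lt k (by omega : i < n), cosetRep_of_lt k hi, ← mul_assoc, ← mul_assoc,
      ← mul_assoc, ← hN.braid i (by omega), mul_assoc,
      nhD_mul_cosetRep_of_lt k (by omega) (by omega), ← mul_assoc]
  | of_succ j hj ih =>
    rw [cosetRep_of_lt k (by omega : j < n), ← mul_assoc,
      ← hN.ddfar j (i + 1) (by omega) (by omega), mul_assoc, ih, mul_assoc]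

/-- The span of the left ideal coset representatives with coefficients in the first `n`
strands. -/
noncomputable def cosetMap (n : ℕ) : (ℕ → NH k n) →ₗ[k] NH k (n + 1) :=
  ∑ j ∈ Finset.range (n + 1), (LinearMap.mulLeft k (cosetRep k n j)).comp
    ((nhEmb k n).toLinearMap.comp (LinearMap.proj j))

theorem cosetMap_apply (n : ℕ) (a : ℕ → NH k n) :
    cosetMap k n a = ∑ j ∈ Finset.range (n + 1), cosetRep k n j * nhEmb k n (a j) := by
  simp [cosetMap]

theorem cosetRep_mul_mem_range {n j : ℕ} (hj : j ≤ n) (a : NH k n) :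
    cosetRep k n j * nhEmb k n a ∈ LinearMap.range (cosetMap k n) := by
  refine ⟨Pi.single j a, ?_⟩
  rw [cosetMap_apply, Finset.sum_eq_single j]
  · simp
  · intro b _ hb
    simp [hb]
  · intro h
    exact absurd (Finset.mem_range.2 (by omega)) h

/-- The span of the elements `∂_j ⋯ ∂_{n-1} a x_n^q` with `q < p`. -/
noncomputable def cosetFiltration (n : ℕ) : ℕ → Submodule k (NH k (n + 1))
  | 0 => ⊥
  | p + 1 => LinearMap.range (cosetMap k n) ⊔
      (cosetFiltration n p).map (LinearMap.mulRight k (nhX k (n + 1) n))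

/-- The span of the elements `∂_j ⋯ ∂_{n-1} a x_n^p`. -/
noncomputable def cosetSpan (n : ℕ) : Submodule k (NH k (n + 1)) :=
  Submodule.span k {v | ∃ (j p : ℕ) (a : NH k n), j ≤ n ∧
    v = cosetRep k n j * nhEmb k n a * nhX k (n + 1) n ^ p}

theorem cosetRep_mem_cosetSpan {n j : ℕ} (hj : j ≤ n) : cosetRep k n j ∈ cosetSpan k n :=
  Submodule.subset_span ⟨j, 0, 1, hj, by simp⟩

theorem mul_mem_cosetSpan {n : ℕ} {v : NH k (n + 1)} (hv : v ∈ cosetSpan k n) (a : NH k n)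
    (p : ℕ) : v * nhEmb k n a * nhX k (n + 1) n ^ p ∈ cosetSpan k n := by
  induction hv using Submodule.span_induction with
  | mem v hv =>
    obtain ⟨j, q, b, hj, rfl⟩ := hv
    refine Submodule.subset_span ⟨j, q + p, b * a, hj, ?_⟩
    have := ((nhEmb_commute_nhX k n a).pow_right q).eq
    rw [map_mul, pow_add, mul_assoc _ (_ ^ q), ← this]
    simp only [mul_assoc]
  | zero => simp
  | add u v _ _ hu hv =>
    rw [add_mul, add_mul]
    exact Submodule.add_mem _ hu hv
  | smul c v _ hv =>
    rw [smul_mul_assoc, smul_mul_assoc]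
    exact Submodule.smul_mem _ c hv

theorem mul_nhEmb_mem_cosetSpan {n : ℕ} {v : NH k (n + 1)} (hv : v ∈ cosetSpan k n)
    (a : NH k n) : v * nhEmb k n a ∈ cosetSpan k n := by
  simpa using mul_mem_cosetSpan k hv a 0

theorem mul_mem_cosetSpan_of_cosetRep {n : ℕ} (g : NH k (n + 1))
    (hg : ∀ j ≤ n, g * cosetRep k n j ∈ cosetSpan k n) (v : NH k (n + 1))
    (hv : v ∈ cosetSpan k n) : g * v ∈ cosetSpan k n := by
  induction hv using Submodule.span_induction with
  | mem v hv =>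
    obtain ⟨j, q, b, hj, rfl⟩ := hv
    rw [← mul_assoc, ← mul_assoc]
    exact mul_mem_cosetSpan k (hg j hj) b q
  | zero => simp
  | add u v _ _ hu hv =>
    rw [mul_add]
    exact Submodule.add_mem _ hu hv
  | smul c v _ hv =>
    rw [mul_smul_comm]
    exact Submodule.smul_mem _ c hv

theorem nhD_mul_mem_cosetSpan {n i : ℕ} (hi : i < n) (v : NH k (n + 1))
    (hv : v ∈ cosetSpan k n) : nhD k (n + 1) i * v ∈ cosetSpan k n := by
  refine mul_mem_cosetSpan_of_cosetRep k _ (fun j hj => ?_) v hv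
  have hm := cosetRep_mem_cosetSpan k hj
  rcases lt_trichotomy i j with h | rfl | h
  · by_cases h' : i + 1 = j
    · subst h'
      rw [← cosetRep_of_lt k hi]
      exact cosetRep_mem_cosetSpan k (by omega)
    · rw [nhD_mul_cosetRep_of_lt k (by omega) hj, ← nhEmb_nhD k (by omega)]
      exact mul_nhEmb_mem_cosetSpan k hm _
  · rw [cosetRep_of_lt k hi, ← mul_assoc, (nilHeckeFamily_nh k (n + 1)).dsq i (by omega),
      zero_mul]
    exact Submodule.zero_mem _
  · obtain ⟨i, rfl⟩ : ∃ i', i = i' + 1 := ⟨i - 1, by omega⟩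
    rw [nhD_succ_mul_cosetRep k (by omega) hi, ← nhEmb_nhD k hi]
    exact mul_nhEmb_mem_cosetSpan k hm _

theorem nhX_mul_mem_cosetSpan {n i : ℕ} (hi : i < n + 1) (v : NH k (n + 1))
    (hv : v ∈ cosetSpan k n) : nhX k (n + 1) i * v ∈ cosetSpan k n := by
  have hN := nilHeckeFamily_nh k (n + 1)
  refine mul_mem_cosetSpan_of_cosetRep k _ (fun j hj => ?_) v hv
  induction hj using Nat.decreasingInduction generalizing i with
  | self =>
    rw [cosetRep_self, mul_one]
    have h1 : (1 : NH k (n + 1)) ∈ cosetSpan k n :=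
      cosetRep_self k n ▸ cosetRep_mem_cosetSpan k le_rfl
    by_cases h : i < n
    · simpa [nhEmb_nhX k h] using mul_nhEmb_mem_cosetSpan k h1 (nhX k n i)
    · obtain rfl : i = n := by omega
      simpa using mul_mem_cosetSpan k h1 1 1
  | of_succ j hj ih =>
    have hm := cosetRep_mem_cosetSpan k (show j + 1 ≤ n from hj)
    rw [cosetRep_of_lt k hj, ← mul_assoc]
    by_cases h : i = j
    · subst h
      rw [hN.xd i (by omega), add_mul, mul_assoc, one_mul]
      exact Submodule.add_mem _ (nhD_mul_mem_cosetSpan k hj _ (ih (by omega))) hm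
    · by_cases h' : i = j + 1
      · subst h'
        rw [eq_sub_of_add_eq (hN.dx j (by omega)).symm, sub_mul, mul_assoc, one_mul]
        exact Submodule.sub_mem _ (nhD_mul_mem_cosetSpan k hj _ (ih (by omega))) hm
      · rw [hN.xd_comm i j hi (by omega) (by omega), mul_assoc]
        exact nhD_mul_mem_cosetSpan k hj _ (ih hi)

theorem cosetSpan_eq_top (n : ℕ) : cosetSpan k n = ⊤ :=
  nh_eq_top_of_left_stable k _ (cosetRep_self k n ▸ cosetRep_mem_cosetSpan k le_rfl)
    (fun _ hi => nhX_mul_mem_cosetSpan k hi)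
    (fun _ hi => nhD_mul_mem_cosetSpan k (by omega))

theorem cosetFiltration_mono (n : ℕ) : Monotone (cosetFiltration k n) := by
  refine monotone_nat_of_le_succ fun p => ?_
  induction p with
  | zero => exact bot_le
  | succ p ih => exact sup_le_sup_left (Submodule.map_mono ih) _

theorem exists_mem_cosetFiltration {n : ℕ} (v : NH k (n + 1)) :
    ∃ p, v ∈ cosetFiltration k n p := by
  have h : cosetSpan k n ≤ ⨆ p, cosetFiltration k n p := by
    refine Submodule.span_le.2 ?_
    rintro _ ⟨j, p, a, hj, rfl⟩
    refine Submodule.mem_iSup_of_mem (p + 1) ?_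
    induction p with
    | zero =>
      rw [pow_zero, mul_one]
      exact Submodule.mem_sup_left (cosetRep_mul_mem_range k hj a)
    | succ p ih =>
      refine Submodule.mem_sup_right ⟨_, ih, ?_⟩
      rw [LinearMap.mulRight_apply, pow_succ, ← mul_assoc]
  rw [cosetSpan_eq_top] at h
  exact (Submodule.mem_iSup_of_directed _ (cosetFiltration_mono k n).directed_le).1
    (h Submodule.mem_top)

theorem exists_eq_cosetMap_add {n : ℕ} (v : NH k (n + 1)) :
    ∃ (a : ℕ → NH k n) (y : NH k (n + 1)), v = cosetMap k n a + y * nhX k (n + 1) n := by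
  obtain ⟨p, hp⟩ := exists_mem_cosetFiltration k v
  cases p with
  | zero =>
    rw [cosetFiltration, Submodule.mem_bot] at hp
    exact ⟨0, 0, by simp [hp]⟩
  | succ p =>
    rw [cosetFiltration] at hp
    obtain ⟨_, ⟨a, rfl⟩, _, ⟨y, _, rfl⟩, rfl⟩ := Submodule.mem_sup.1 hp
    exact ⟨a, y, rfl⟩

/-! ## Faithfulness of the action on polynomials -/

/-- The substitution `X n ↦ 0`, shifting the later variables down. -/
noncomputable def killVar (n : ℕ) : MvPolynomial ℕ k →ₐ[k] MvPolynomial ℕ k :=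
  MvPolynomial.aeval fun i =>
    if i < n then MvPolynomial.X i else if i = n then 0 else MvPolynomial.X (i - 1)

@[simp] theorem killVar_X_self (n : ℕ) : killVar k n (MvPolynomial.X n) = 0 := by simp [killVar]

theorem killVar_X_of_lt {n i : ℕ} (h : i < n) :
    killVar k n (MvPolynomial.X i) = MvPolynomial.X i := by simp [killVar, h]

theorem killVar_surjective (n : ℕ) : Function.Surjective (killVar k n) := by
  intro g
  refine ⟨MvPolynomial.rename (fun i => if i < n then i else i + 1) g, ?_⟩
  simp only [killVar, MvPolynomial.aeval_rename]
  convert MvPolynomial.aeval_X_left_apply g using 3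
  funext i
  by_cases h : i < n
  · simp [h]
  · simp [h, show ¬ i + 1 < n by omega, show i + 1 ≠ n by omega]

theorem killVar_succ_varSwap (n : ℕ) (f : MvPolynomial ℕ k) :
    killVar k (n + 1) (varSwap k n f) = killVar k n f := by
  simp only [killVar, varSwap, MvPolynomial.aeval_rename]
  congr 2
  funext i
  simp only [Function.comp_apply, Equiv.swap_apply_def]
  by_cases h : i = n
  · simp [h]
  · by_cases h' : i = n + 1
    · simp [h']
    · by_cases h2 : i < n
      · simp [h, h', h2, show i < n + 1 by omega]
      · simp [h, h', h2, show ¬ i < n + 1 by omega]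

theorem killVar_varSwap {n i : ℕ} (h : i + 1 < n) (f : MvPolynomial ℕ k) :
    killVar k n (varSwap k i f) = varSwap k i (killVar k n f) := by
  suffices (killVar k n).comp (varSwap k i) = (varSwap k i).comp (killVar k n) from
    DFunLike.congr_fun this f
  ext1 j
  simp only [AlgHom.comp_apply]
  by_cases h1 : j = i
  · subst h1
    rw [varSwap_X_self, killVar_X_of_lt k h, killVar_X_of_lt k (by omega), varSwap_X_self]
  · by_cases h2 : j = i + 1
    · subst h2
      rw [varSwap_X_succ, killVar_X_of_lt k h, killVar_X_of_lt k (by omega), varSwap_X_succ]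
    · rw [varSwap_X_of_ne k h1 h2]
      by_cases h3 : j < n
      · rw [killVar_X_of_lt k h3, varSwap_X_of_ne k h1 h2]
      · by_cases h4 : j = n
        · simp [h4]
        · simp only [killVar, MvPolynomial.aeval_X, h3, h4, if_false]
          rw [varSwap_X_of_ne k (by omega) (by omega)]

theorem killVar_dividedDiff {n i : ℕ} (h : i + 1 < n) (f : MvPolynomial ℕ k) :
    killVar k n (dividedDiff k i f) = dividedDiff k i (killVar k n f) := by
  symm
  apply dividedDiff_eq_of_mul
  have := congrArg (killVar k n) (dividedDiff_spec k i f)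
  rw [map_mul, map_sub, map_sub, killVar_X_of_lt k h, killVar_X_of_lt k (by omega),
    killVar_varSwap k h] at this
  exact this

theorem killVar_nhAct_nhEmb {n : ℕ} (a : NH k n) (f : MvPolynomial ℕ k) :
    killVar k n (nhAct k f (nhEmb k n a)) = nhAct k (killVar k n f) a := by
  let S : Submodule k (NH k n) :=
    { carrier := {a | ∀ f, killVar k n (nhAct k f (nhEmb k n a)) = nhAct k (killVar k n f) a}
      add_mem' := fun {a b} ha hb f => by
        rw [map_add, nhAct_add, map_add, ha, hb, nhAct_add]
      zero_mem' := fun f => by rw [map_zero, nhAct_zero, map_zero, nhAct_zero]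
      smul_mem' := fun c a ha f => by rw [map_smul, nhAct_smul, map_smul, ha, nhAct_smul] }
  have hS : S = ⊤ := by
    refine nh_eq_top_of_left_stable k S (fun f => ?_) (fun i hi s hs f => ?_)
      (fun i hi s hs f => ?_)
    · rw [map_one, nhAct_one, nhAct_one]
    · rw [map_mul, nhAct_mul, nhAct_mul, hs, nhEmb_nhX k hi, nhAct_nhX k (by omega),
        nhAct_nhX k hi, map_mul, killVar_X_of_lt k hi]
    · rw [map_mul, nhAct_mul, nhAct_mul, hs, nhEmb_nhD k hi, nhAct_nhD k (by omega),
        nhAct_nhD k hi, killVar_dividedDiff k hi]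
  have ha : a ∈ S := hS ▸ Submodule.mem_top
  exact ha f

theorem consecProd_dividedDiffOp_X_mul (j l m : ℕ) (h : j + l < m) (f : MvPolynomial ℕ k) :
    (consecProd (dividedDiffOp k) j l).unop (MvPolynomial.X m * f) =
      MvPolynomial.X m * (consecProd (dividedDiffOp k) j l).unop f := by
  induction l with
  | zero => simp [consecProd]
  | succ l ih =>
    rw [consecProd_succ_right, MulOpposite.unop_mul, Module.End.mul_apply, Module.End.mul_apply,
      ih (by omega)]
    exact dividedDiff_X_mul_of_ne k (by omega) (by omega) _

/-- The coset representatives followed by the substitution `X n ↦ 0` are jointly surjective. -/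
theorem exists_killVar_consecProd (n : ℕ) (g : ℕ → MvPolynomial ℕ k) :
    ∃ f, ∀ j ≤ n, killVar k n ((consecProd (dividedDiffOp k) j (n - j)).unop f) = g j := by
  induction n generalizing g with
  | zero =>
    obtain ⟨f, hf⟩ := killVar_surjective k 0 (g 0)
    refine ⟨f, fun j hj => ?_⟩
    obtain rfl : j = 0 := by omega
    simpa [consecProd] using hf
  | succ n ih =>
    obtain ⟨f, hf⟩ := killVar_surjective k (n + 1) (g (n + 1))
    obtain ⟨q, hq⟩ := ih fun j =>
      killVar k (n + 1) ((consecProd (dividedDiffOp k) j (n + 1 - j)).unop f) - g j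
    refine ⟨f + MvPolynomial.X (n + 1) * q, fun j hj => ?_⟩
    by_cases h : j = n + 1
    · subst h
      simp [consecProd, hf]
    · have hjn : j ≤ n := by omega
      rw [map_add, map_add]
      have : killVar k (n + 1) ((consecProd (dividedDiffOp k) j (n + 1 - j)).unop
          (MvPolynomial.X (n + 1) * q)) =
          - killVar k n ((consecProd (dividedDiffOp k) j (n - j)).unop q) := by
        rw [show n + 1 - j = n - j + 1 by omega, consecProd_succ_right, MulOpposite.unop_mul,
          Module.End.mul_apply, consecProd_dividedDiffOp_X_mul k _ _ _ (by omega),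
          show j + (n - j) = n by omega]
        simp only [dividedDiffOp, MulOpposite.unop_op]
        rw [dividedDiff_X_mul_succ', map_sub, map_mul, killVar_X_self, zero_mul, zero_sub,
          killVar_succ_varSwap]
      rw [this, hq j hjn]
      ring

theorem nhAct_cosetRep (n j : ℕ) (hj : j ≤ n) (f : MvPolynomial ℕ k) :
    nhAct k f (cosetRep k n j) = (consecProd (dividedDiffOp k) j (n - j)).unop f := by
  rw [nhAct, cosetRep, map_consecProd (nhRep k (n + 1)) _ (dividedDiffOp k)]
  intro i _ hi
  exact NilHeckeFamily.lift_nhD k _ (by omega)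

theorem eq_zero_of_nhAct_cosetMap_add {n : ℕ}
    (hn : ∀ a : NH k n, (∀ f, nhAct k f a = 0) → a = 0) (a : ℕ → NH k n) (y : NH k (n + 1))
    (h : ∀ f, nhAct k f (cosetMap k n a + y * nhX k (n + 1) n) = 0) (j : ℕ) (hj : j ≤ n) :
    a j = 0 := by
  refine hn _ fun p => ?_
  obtain ⟨f, hf⟩ := exists_killVar_consecProd k n (Pi.single j p)
  have := congrArg (killVar k n) (h f)
  rw [nhAct_add, nhAct_mul, nhAct_nhX k (by omega), map_add, map_mul, killVar_X_self, zero_mul,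
    add_zero, cosetMap_apply, nhAct_sum, map_sum, map_zero, Finset.sum_eq_single j] at this
  · rwa [nhAct_mul, killVar_nhAct_nhEmb, nhAct_cosetRep k n j hj, hf j hj, Pi.single_eq_same]
      at this
  · intro i hi hij
    rw [nhAct_mul, killVar_nhAct_nhEmb, nhAct_cosetRep k n i (by simp at hi; omega),
      hf i (by simp at hi; omega), Pi.single_eq_of_ne hij, zero_nhAct]
  · intro hj'
    exact absurd (Finset.mem_range.2 (by omega)) hj'

theorem cosetMap_eq_zero {n : ℕ} {a : ℕ → NH k n} (h : ∀ j ≤ n, a j = 0) :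
    cosetMap k n a = 0 := by
  rw [cosetMap_apply]
  refine Finset.sum_eq_zero fun j hj => ?_
  rw [h j (by simp at hj; omega), map_zero, mul_zero]

theorem nh_zero_eq_smul_one (a : NH k 0) : ∃ c : k, a = c • 1 := by
  have : Submodule.span k {(1 : NH k 0)} = ⊤ :=
    nh_eq_top_of_left_stable k _ (Submodule.mem_span_singleton_self _)
      (fun i hi => by omega) (fun i hi => by omega)
  obtain ⟨c, hc⟩ := Submodule.mem_span_singleton.1 (this ▸ Submodule.mem_top : a ∈ _)
  exact ⟨c, hc.symm⟩

/-- The nilHecke algebra acts faithfully on polynomials. -/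
theorem eq_zero_of_nhAct (n : ℕ) (a : NH k n) (h : ∀ f, nhAct k f a = 0) : a = 0 := by
  induction n with
  | zero =>
    obtain ⟨c, rfl⟩ := nh_zero_eq_smul_one k a
    have := h 1
    rw [nhAct_smul, nhAct_one, smul_eq_zero] at this
    rw [this.resolve_right one_ne_zero, zero_smul]
  | succ n ih =>
    obtain ⟨p, hp⟩ := exists_mem_cosetFiltration k a
    induction p generalizing a with
    | zero => simpa [cosetFiltration] using hp
    | succ p ihp =>
      rw [cosetFiltration] at hp
      obtain ⟨_, ⟨b, rfl⟩, _, ⟨y, hy, rfl⟩, rfl⟩ := Submodule.mem_sup.1 hp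
      rw [LinearMap.mulRight_apply] at h ⊢
      have hb := eq_zero_of_nhAct_cosetMap_add k ih b y h
      rw [cosetMap_eq_zero k hb, zero_add] at h ⊢
      rw [ihp y (fun f => ?_) hy, zero_mul]
      have := h f
      rw [nhAct_mul, nhAct_nhX k (by omega)] at this
      exact (mul_eq_zero.1 this).resolve_left (MvPolynomial.X_ne_zero n)

theorem eq_zero_of_cosetMap_add_eq_zero {n : ℕ} (a : ℕ → NH k n) (y : NH k (n + 1))
    (h : cosetMap k n a + y * nhX k (n + 1) n = 0) (j : ℕ) (hj : j ≤ n) : a j = 0 :=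
  eq_zero_of_nhAct_cosetMap_add k (eq_zero_of_nhAct k n) a y
    (fun f => by rw [h, nhAct_zero]) j hj

/-! ## The two bimodules -/

theorem algHom_tmul_polynomial {A B : Type*} [Ring A] [Algebra k A] [Ring B] [Algebra k B]
    (φ : A ⊗[k] Polynomial k →ₐ[k] B) (a : A) (p : Polynomial k) :
    φ (a ⊗ₜ p) = φ (a ⊗ₜ p.divX) * φ (1 ⊗ₜ Polynomial.X) +
      Polynomial.eval 0 p • φ (a ⊗ₜ 1) := by
  rw [← map_mul, Algebra.TensorProduct.tmul_mul_tmul, mul_one, ← map_smul, ← map_add,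
    ← TensorProduct.tmul_smul, ← TensorProduct.tmul_add, ← Polynomial.coeff_zero_eq_eval_zero,
    Polynomial.smul_eq_C_mul, mul_one, Polynomial.divX_mul_X_add]

theorem submodule_eq_top_of_tmul {B W Q : Type*} [AddCommGroup B] [Module k B] [AddCommGroup W]
    [Module k W] [AddCommGroup Q] [Module k Q] (π : B ⊗[k] (W ⊗[k] k) →ₗ[k] Q)
    (hπ : Function.Surjective π) (S : Submodule k Q)
    (hS : ∀ v w, π (v ⊗ₜ (w ⊗ₜ 1)) ∈ S) : S = ⊤ := by
  rw [eq_top_iff]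
  rintro q -
  obtain ⟨t, rfl⟩ := hπ q
  induction t using TensorProduct.induction_on with
  | zero => simp
  | tmul v t =>
    have := hS v (TensorProduct.rid k W t)
    rwa [← TensorProduct.rid_symm_apply, LinearEquiv.symm_apply_apply] at this
  | add x y hx hy =>
    rw [map_add]
    exact S.add_mem hx hy

section RelM

variable {k} {n : ℕ} (φ : NH k n ⊗[k] Polynomial k →ₐ[k] NH k (n + 1))

theorem relM_mkQ_mul_nhEmb (hφ : ∀ a, φ (a ⊗ₜ 1) = nhEmb k n a) (u : NH k (n + 1))
    (a w : NH k n) (c : k) :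
    (relM k n φ).mkQ ((u * nhEmb k n a) ⊗ₜ (w ⊗ₜ c)) =
      (relM k n φ).mkQ (u ⊗ₜ ((a * w) ⊗ₜ c)) := by
  refine (Submodule.Quotient.eq _).2 (Submodule.subset_span ⟨u, a, 1, w, c, ?_⟩)
  rw [hφ, Polynomial.eval_one, one_mul]

theorem relM_mkQ_mul_nhX (hφt : φ ((1 : NH k n) ⊗ₜ Polynomial.X) = nhX k (n + 1) n)
    (u : NH k (n + 1)) (w : NH k n) (c : k) :
    (relM k n φ).mkQ ((u * nhX k (n + 1) n) ⊗ₜ (w ⊗ₜ c)) = 0 := by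
  refine (Submodule.Quotient.mk_eq_zero _).2
    (Submodule.subset_span ⟨u, 1, Polynomial.X, w, c, ?_⟩)
  rw [hφt, Polynomial.eval_X, zero_mul, TensorProduct.tmul_zero, TensorProduct.tmul_zero, sub_zero]

/-- The map `v ⊗ (w ⊗ c) ↦ c • v w`. -/
noncomputable def tensorMul (k : Type) [Field k] (n : ℕ) :
    NH k (n + 1) ⊗[k] (NH k n ⊗[k] k) →ₗ[k] NH k (n + 1) :=
  (LinearMap.mul' k (NH k (n + 1))).comp
    (TensorProduct.map LinearMap.id
      ((nhEmb k n).toLinearMap.comp (TensorProduct.rid k (NH k n)).toLinearMap))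

theorem tensorMul_tmul (v : NH k (n + 1)) (w : NH k n) (c : k) :
    tensorMul k n (v ⊗ₜ (w ⊗ₜ c)) = v * nhEmb k n (c • w) := by
  simp [tensorMul]

theorem tensorMul_mem_of_mem_relM (hφ : ∀ a, φ (a ⊗ₜ 1) = nhEmb k n a)
    (hφt : φ ((1 : NH k n) ⊗ₜ Polynomial.X) = nhX k (n + 1) n)
    {t : NH k (n + 1) ⊗[k] (NH k n ⊗[k] k)} (ht : t ∈ relM k n φ) :
    ∃ y, tensorMul k n t = y * nhX k (n + 1) n := by
  have : relM k n φ ≤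
      (LinearMap.range (LinearMap.mulRight k (nhX k (n + 1) n))).comap (tensorMul k n) := by
    refine Submodule.span_le.2 ?_
    rintro _ ⟨v, a, p, w, c, rfl⟩
    refine ⟨v * φ (a ⊗ₜ p.divX) * nhEmb k n (c • w), ?_⟩
    rw [map_sub, tensorMul_tmul, tensorMul_tmul, algHom_tmul_polynomial k φ a p, hφ, hφt,
      LinearMap.mulRight_apply, mul_assoc _ (nhEmb k n _), (nhEmb_commute_nhX k n _).eq]
    simp only [mul_add, add_mul, map_smul, map_mul, smul_mul_assoc, mul_smul_comm,
      mul_assoc]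
    rw [smul_add, smul_smul, mul_comm c, add_sub_cancel_right]
  obtain ⟨y, hy⟩ := this ht
  exact ⟨y, hy.symm⟩

/-- The map `a ↦ 1 ⊗ (a ⊗ 1)`. -/
noncomputable def relMUnit :
    NH k n →ₗ[k] (NH k (n + 1) ⊗[k] (NH k n ⊗[k] k)) ⧸ relM k n φ :=
  (relM k n φ).mkQ.comp ((TensorProduct.mk k (NH k (n + 1)) (NH k n ⊗[k] k) 1).comp
    (TensorProduct.rid k (NH k n)).symm.toLinearMap)

theorem relMUnit_apply (a : NH k n) :
    relMUnit φ a = (relM k n φ).mkQ (1 ⊗ₜ (a ⊗ₜ 1)) := by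
  simp [relMUnit]

theorem relMUnit_smul_mul (hφ : ∀ a, φ (a ⊗ₜ 1) = nhEmb k n a) (u w : NH k n) (c : k) :
    (relM k n φ).mkQ (nhEmb k n u ⊗ₜ (w ⊗ₜ c)) = relMUnit φ (c • (u * w)) := by
  rw [← one_mul (nhEmb k n u), relM_mkQ_mul_nhEmb φ hφ, relMUnit_apply, TensorProduct.smul_tmul,
    smul_eq_mul, mul_one]

theorem relMUnit_injective (hφ : ∀ a, φ (a ⊗ₜ 1) = nhEmb k n a)
    (hφt : φ ((1 : NH k n) ⊗ₜ Polynomial.X) = nhX k (n + 1) n) :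
    Function.Injective (relMUnit φ) := by
  refine (injective_iff_map_eq_zero _).2 fun a ha => ?_
  rw [relMUnit_apply] at ha
  obtain ⟨y, hy⟩ := tensorMul_mem_of_mem_relM φ hφ hφt ((Submodule.Quotient.mk_eq_zero _).1 ha)
  rw [tensorMul_tmul, one_smul, one_mul] at hy
  have := eq_zero_of_cosetMap_add_eq_zero k (Pi.single n a) (-y) ?_ n le_rfl
  · simpa using this
  · rw [cosetMap_apply, Finset.sum_eq_single n]
    · rw [Pi.single_eq_same, cosetRep_self, one_mul, hy, neg_mul, add_neg_cancel]
    · intro b _ hb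
      rw [Pi.single_eq_of_ne hb, map_zero, mul_zero]
    · simp

end RelM

section Cokernel

variable {k} {m : ℕ}

theorem relN_mkQ_mul_nhEmb (φ' : NH k m ⊗[k] Polynomial k →ₐ[k] NH k (m + 1))
    (hφ' : ∀ a, φ' (a ⊗ₜ 1) = nhEmb k m a) (u : NH k (m + 1)) (a : NH k m) (w : NH k (m + 1))
    (c : k) :
    (relN k (m + 1) φ' (nhEmb k m)).mkQ ((u * nhEmb k m a) ⊗ₜ (w ⊗ₜ c)) =
      (relN k (m + 1) φ' (nhEmb k m)).mkQ (u ⊗ₜ ((nhEmb k m a * w) ⊗ₜ c)) := by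
  refine (Submodule.Quotient.eq _).2 (Submodule.subset_span ⟨u, a, 1, w, c, ?_⟩)
  rw [show φ' (a ⊗ₜ 1) = nhEmb k m a from hφ' a, Polynomial.eval_one, one_mul]

theorem relN_mkQ_mul_nhX (φ' : NH k m ⊗[k] Polynomial k →ₐ[k] NH k (m + 1))
    (hφ't : φ' ((1 : NH k m) ⊗ₜ Polynomial.X) = nhX k (m + 1) m)
    (u w : NH k (m + 1)) (c : k) :
    (relN k (m + 1) φ' (nhEmb k m)).mkQ ((u * nhX k (m + 1) m) ⊗ₜ (w ⊗ₜ c)) = 0 := by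
  refine (Submodule.Quotient.mk_eq_zero _).2
    (Submodule.subset_span ⟨u, (1 : NH k m), Polynomial.X, w, c, ?_⟩)
  rw [show φ' ((1 : NH k m) ⊗ₜ Polynomial.X) = nhX k (m + 1) m from hφ't, Polynomial.eval_X,
    zero_mul, TensorProduct.tmul_zero, TensorProduct.tmul_zero, sub_zero]

/-- The family of elements `∂_j ⋯ ∂_{m-1} ⊗ (a_j ⊗ 1)` exhausts the bimodule. -/
theorem exists_relN_eq_sum (φ' : NH k m ⊗[k] Polynomial k →ₐ[k] NH k (m + 1))
    (hφ' : ∀ a, φ' (a ⊗ₜ 1) = nhEmb k m a)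
    (hφ't : φ' ((1 : NH k m) ⊗ₜ Polynomial.X) = nhX k (m + 1) m)
    (z : (NH k (m + 1) ⊗[k] (NH k (m + 1) ⊗[k] k)) ⧸ relN k (m + 1) φ' (nhEmb k m)) :
    ∃ a : ℕ → NH k (m + 1), z = ∑ j ∈ Finset.range (m + 1),
      (relN k (m + 1) φ' (nhEmb k m)).mkQ (cosetRep k m j ⊗ₜ (a j ⊗ₜ 1)) := by
  let S : Submodule k
      ((NH k (m + 1) ⊗[k] (NH k (m + 1) ⊗[k] k)) ⧸ relN k (m + 1) φ' (nhEmb k m)) :=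
    { carrier := {z | ∃ a : ℕ → NH k (m + 1), z = ∑ j ∈ Finset.range (m + 1),
        (relN k (m + 1) φ' (nhEmb k m)).mkQ (cosetRep k m j ⊗ₜ (a j ⊗ₜ 1))}
      zero_mem' := ⟨0, by simp⟩
      add_mem' := by
        rintro _ _ ⟨a, rfl⟩ ⟨b, rfl⟩
        refine ⟨a + b, ?_⟩
        rw [← Finset.sum_add_distrib]
        refine Finset.sum_congr rfl fun j _ => ?_
        rw [Pi.add_apply, TensorProduct.add_tmul, TensorProduct.tmul_add, map_add]
      smul_mem' := by
        rintro c _ ⟨a, rfl⟩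
        refine ⟨c • a, ?_⟩
        rw [Finset.smul_sum]
        refine Finset.sum_congr rfl fun j _ => ?_
        rw [Pi.smul_apply, ← TensorProduct.smul_tmul', TensorProduct.tmul_smul, map_smul] }
  have hS : S = ⊤ := by
    refine submodule_eq_top_of_tmul k _ (Submodule.mkQ_surjective _) S fun v w => ?_
    obtain ⟨b, y, rfl⟩ := exists_eq_cosetMap_add k v
    refine ⟨fun j => nhEmb k m (b j) * w, ?_⟩
    rw [TensorProduct.add_tmul, map_add, relN_mkQ_mul_nhX φ' hφ't, add_zero, cosetMap_apply,
      TensorProduct.sum_tmul, map_sum]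
    exact Finset.sum_congr rfl fun j _ => relN_mkQ_mul_nhEmb φ' hφ' _ _ _ _
  have hz : z ∈ S := hS ▸ Submodule.mem_top
  exact hz

/-- The map `v ⊗ t ↦ v ∂_m ⊗ t` to the cokernel of the unit. -/
noncomputable def toCokernel (φ : NH k (m + 1) ⊗[k] Polynomial k →ₐ[k] NH k (m + 2)) :
    NH k (m + 1) ⊗[k] (NH k (m + 1) ⊗[k] k) →ₗ[k]
      ((NH k (m + 2) ⊗[k] (NH k (m + 1) ⊗[k] k)) ⧸ relM k (m + 1) φ) ⧸
        LinearMap.range (relMUnit φ) :=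
  (LinearMap.range (relMUnit φ)).mkQ.comp ((relM k (m + 1) φ).mkQ.comp
    (TensorProduct.map ((LinearMap.mulRight k (nhD k (m + 2) m)).comp
      (nhEmb k (m + 1)).toLinearMap) LinearMap.id))

theorem toCokernel_tmul (φ : NH k (m + 1) ⊗[k] Polynomial k →ₐ[k] NH k (m + 2))
    (v : NH k (m + 1)) (t : NH k (m + 1) ⊗[k] k) :
    toCokernel φ (v ⊗ₜ t) = (LinearMap.range (relMUnit φ)).mkQ
      ((relM k (m + 1) φ).mkQ ((nhEmb k (m + 1) v * nhD k (m + 2) m) ⊗ₜ t)) := by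
  simp [toCokernel]

theorem relN_le_ker_toCokernel (φ : NH k (m + 1) ⊗[k] Polynomial k →ₐ[k] NH k (m + 2))
    (hφ : ∀ a, φ (a ⊗ₜ 1) = nhEmb k (m + 1) a)
    (hφt : φ ((1 : NH k (m + 1)) ⊗ₜ Polynomial.X) = nhX k (m + 2) (m + 1))
    (φ' : NH k m ⊗[k] Polynomial k →ₐ[k] NH k (m + 1))
    (hφ' : ∀ a, φ' (a ⊗ₜ 1) = nhEmb k m a)
    (hφ't : φ' ((1 : NH k m) ⊗ₜ Polynomial.X) = nhX k (m + 1) m) :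
    relN k (m + 1) φ' (nhEmb k m) ≤ LinearMap.ker (toCokernel φ) := by
  refine Submodule.span_le.2 ?_
  rintro _ ⟨v, a, p, w, c, rfl⟩
  have hp : φ' (a ⊗ₜ p) = φ' (a ⊗ₜ p.divX) * nhX k (m + 1) m +
      Polynomial.eval 0 p • nhEmb k m a := by
    rw [← hφ't, ← hφ' a]
    exact algHom_tmul_polynomial k φ' a p
  have hx : ∀ u : NH k (m + 1), toCokernel φ ((u * nhX k (m + 1) m) ⊗ₜ (w ⊗ₜ c)) = 0 := by
    intro u
    rw [toCokernel_tmul, map_mul, nhEmb_nhX k m.lt_succ_self, mul_assoc,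
      (nilHeckeFamily_nh k (m + 2)).xd m (by omega), mul_add, mul_one, ← mul_assoc,
      TensorProduct.add_tmul, map_add, relM_mkQ_mul_nhX φ hφt, zero_add,
      relMUnit_smul_mul φ hφ]
    exact (Submodule.Quotient.mk_eq_zero _).2 ⟨_, rfl⟩
  have ha : toCokernel φ ((v * nhEmb k m a) ⊗ₜ (w ⊗ₜ c)) =
      toCokernel φ (v ⊗ₜ ((nhEmb k m a * w) ⊗ₜ c)) := by
    rw [toCokernel_tmul, toCokernel_tmul, map_mul, mul_assoc,
      (nhEmb_nhEmb_commute_nhD k m a).eq, ← mul_assoc, relM_mkQ_mul_nhEmb φ hφ]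
  rw [SetLike.mem_coe, LinearMap.mem_ker, map_sub, sub_eq_zero]
  refine (congrArg (fun b => toCokernel φ ((v * b) ⊗ₜ (w ⊗ₜ c))) hp).trans ?_
  rw [mul_add, TensorProduct.add_tmul, map_add, ← mul_assoc, hx, zero_add, mul_smul_comm,
    ← TensorProduct.smul_tmul', map_smul, ha, ← map_smul, ← TensorProduct.tmul_smul,
    ← TensorProduct.tmul_smul, smul_eq_mul]

theorem cosetMap_succ (a : ℕ → NH k (m + 1)) :
    cosetMap k (m + 1) a = (∑ j ∈ Finset.range (m + 1), nhEmb k (m + 1) (cosetRep k m j) *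
      nhD k (m + 2) m * nhEmb k (m + 1) (a j)) + nhEmb k (m + 1) (a (m + 1)) := by
  rw [cosetMap_apply, Finset.sum_range_succ, cosetRep_self, one_mul]
  congr 1
  refine Finset.sum_congr rfl fun j hj => ?_
  rw [cosetRep_succ k (by simp at hj; omega)]

theorem range_toCokernel (φ : NH k (m + 1) ⊗[k] Polynomial k →ₐ[k] NH k (m + 2))
    (hφ : ∀ a, φ (a ⊗ₜ 1) = nhEmb k (m + 1) a)
    (hφt : φ ((1 : NH k (m + 1)) ⊗ₜ Polynomial.X) = nhX k (m + 2) (m + 1)) :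
    LinearMap.range (toCokernel φ) = ⊤ := by
  refine submodule_eq_top_of_tmul k ((LinearMap.range (relMUnit φ)).mkQ.comp
    (relM k (m + 1) φ).mkQ) ((Submodule.mkQ_surjective _).comp (Submodule.mkQ_surjective _)) _
    fun v w => ?_
  obtain ⟨a, y, rfl⟩ := exists_eq_cosetMap_add k v
  refine ⟨∑ j ∈ Finset.range (m + 1), cosetRep k m j ⊗ₜ ((a j * w) ⊗ₜ 1), ?_⟩
  have h0 : ∀ b, (LinearMap.range (relMUnit φ)).mkQ (relMUnit φ b) = 0 :=
    fun b => (Submodule.Quotient.mk_eq_zero _).2 ⟨b, rfl⟩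
  rw [LinearMap.comp_apply, TensorProduct.add_tmul, map_add, relM_mkQ_mul_nhX φ hφt, add_zero,
    cosetMap_succ, TensorProduct.add_tmul, map_add, relMUnit_smul_mul φ hφ, map_add, h0,
    add_zero, TensorProduct.sum_tmul, map_sum, map_sum, map_sum]
  refine Finset.sum_congr rfl fun j _ => ?_
  rw [toCokernel_tmul, relM_mkQ_mul_nhEmb φ hφ]

theorem eq_zero_of_toCokernel_eq_zero
    (φ : NH k (m + 1) ⊗[k] Polynomial k →ₐ[k] NH k (m + 2))
    (hφ : ∀ a, φ (a ⊗ₜ 1) = nhEmb k (m + 1) a)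
    (hφt : φ ((1 : NH k (m + 1)) ⊗ₜ Polynomial.X) = nhX k (m + 2) (m + 1))
    (a : ℕ → NH k (m + 1))
    (h : toCokernel φ (∑ j ∈ Finset.range (m + 1), cosetRep k m j ⊗ₜ (a j ⊗ₜ 1)) = 0)
    (j : ℕ) (hj : j ≤ m) : a j = 0 := by
  rw [map_sum] at h
  simp only [toCokernel_tmul] at h
  rw [← map_sum, ← map_sum] at h
  obtain ⟨b, hb⟩ := (Submodule.Quotient.mk_eq_zero _).1 h
  rw [relMUnit_apply] at hb
  obtain ⟨y, hy⟩ := tensorMul_mem_of_mem_relM φ hφ hφt ((Submodule.Quotient.eq _).1 hb)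
  simp only [map_sub, map_sum, tensorMul_tmul, one_smul, one_mul] at hy
  have := eq_zero_of_cosetMap_add_eq_zero k (fun i => if i ≤ m then a i else -b) y ?_ j (by omega)
  · simpa [hj] using this
  · rw [cosetMap_succ, ← hy, if_neg (by omega), map_neg]
    rw [Finset.sum_congr rfl fun i hi => by
      rw [if_pos (show i ≤ m by simp at hi; omega)]]
    abel

/-- The cokernel of the unit is the bimodule induced from one strand fewer. -/
noncomputable def relNEquivCokernel (φ : NH k (m + 1) ⊗[k] Polynomial k →ₐ[k] NH k (m + 2))
    (hφ : ∀ a, φ (a ⊗ₜ 1) = nhEmb k (m + 1) a)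
    (hφt : φ ((1 : NH k (m + 1)) ⊗ₜ Polynomial.X) = nhX k (m + 2) (m + 1))
    (φ' : NH k m ⊗[k] Polynomial k →ₐ[k] NH k (m + 1))
    (hφ' : ∀ a, φ' (a ⊗ₜ 1) = nhEmb k m a)
    (hφ't : φ' ((1 : NH k m) ⊗ₜ Polynomial.X) = nhX k (m + 1) m) :
    ((NH k (m + 1) ⊗[k] (NH k (m + 1) ⊗[k] k)) ⧸ relN k (m + 1) φ' (nhEmb k m)) ≃ₗ[k]
      ((NH k (m + 2) ⊗[k] (NH k (m + 1) ⊗[k] k)) ⧸ relM k (m + 1) φ) ⧸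
        LinearMap.range (relMUnit φ) :=
  LinearEquiv.ofBijective
    ((relN k (m + 1) φ' (nhEmb k m)).liftQ (toCokernel φ)
      (relN_le_ker_toCokernel φ hφ hφt φ' hφ' hφ't)) <| by
    constructor
    · refine (injective_iff_map_eq_zero _).2 fun z hz => ?_
      obtain ⟨a, rfl⟩ := exists_relN_eq_sum φ' hφ' hφ't z
      rw [← map_sum] at hz
      have ha := eq_zero_of_toCokernel_eq_zero φ hφ hφt a hz
      refine Finset.sum_eq_zero fun j hj => ?_
      rw [ha j (by simp at hj; omega), TensorProduct.zero_tmul, TensorProduct.tmul_zero, map_zero]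
    · rw [← LinearMap.range_eq_top, Submodule.range_liftQ]
      exact range_toCokernel φ hφ hφt

end Cokernel

set_option synthInstance.maxHeartbeats 1000000 in
set_option maxHeartbeats 1000000 in
/-- let `k` be a field and `n ≥ 1`.  With `φ : NH_n ⊗ k[t] → NH_{n+1}`
(first `n` strands, `t ↦ x_{n+1}`), `φ' : NH_{n-1} ⊗ k[t] → NH_n` (first `n-1`
strands, `t ↦ x_n`), `ι : NH_n → NH_{n+1}` and `ι' : NH_{n-1} → NH_n` the
first-strands embeddings, form the `(NH_n, NH_n)`-bimodules
`M = NH_{n+1} ⊗_{NH_n ⊗ k[t]} (NH_n ⊗ k₀)` and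
`N = NH_n ⊗_{NH_{n-1} ⊗ k[t]} (NH_n ⊗ k₀)` (realized as quotients by the balancing
relations `relM`, `relN`; the left `NH_n`-action on `M` is via `ι` on the first
factor, the right action is right multiplication on the `NH_n` tensor factor, and
similarly for `N`).  Then `a ↦ 1 ⊗ (a ⊗ 1)` is an injective bimodule homomorphism
`NH_n → M`, and its cokernel is isomorphic to `N` via the map induced by
`v ⊗ (w ⊗ 1) ↦ (v·∂_n) ⊗ (w ⊗ 1)`; i.e. there is a short exact sequence of
`(NH_n, NH_n)`-bimodules `0 → NH_n → M → N → 0`. -/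
theorem stmt_17 (hn : 1 ≤ n)
    (φ : NH k n ⊗[k] Polynomial k →ₐ[k] NH k (n + 1))
    (hφx : ∀ i : Fin n, φ (xg k n i ⊗ₜ[k] 1) = xg k (n + 1) (Fin.castSucc i))
    (hφd : ∀ j : DIdx n, φ (dg k n j ⊗ₜ[k] 1)
        = dg k (n + 1) ⟨Fin.castSucc j.1,
            by have := j.2; simp only [Fin.coe_castSucc]; omega⟩)
    (hφt : φ ((1 : NH k n) ⊗ₜ[k] Polynomial.X) = xg k (n + 1) (Fin.last n))
    (φ' : NH k (n - 1) ⊗[k] Polynomial k →ₐ[k] NH k n)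
    (hφ'x : ∀ i : Fin (n - 1), φ' (xg k (n - 1) i ⊗ₜ[k] 1)
        = xg k n ⟨(i : ℕ), by have := i.isLt; omega⟩)
    (hφ'd : ∀ j : DIdx (n - 1), φ' (dg k (n - 1) j ⊗ₜ[k] 1)
        = dg k n ⟨⟨(j.1 : ℕ), by have := j.1.isLt; omega⟩,
            by have := j.2; simp only [Fin.val_mk]; omega⟩)
    (hφ't : φ' ((1 : NH k (n - 1)) ⊗ₜ[k] Polynomial.X) = xg k n ⟨n - 1, by omega⟩)
    (ι : NH k n →ₐ[k] NH k (n + 1))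
    (hιx : ∀ i : Fin n, ι (xg k n i) = xg k (n + 1) (Fin.castSucc i))
    (hιd : ∀ j : DIdx n, ι (dg k n j)
        = dg k (n + 1) ⟨Fin.castSucc j.1,
            by have := j.2; simp only [Fin.coe_castSucc]; omega⟩)
    (ι' : NH k (n - 1) →ₐ[k] NH k n)
    (hι'x : ∀ i : Fin (n - 1), ι' (xg k (n - 1) i)
        = xg k n ⟨(i : ℕ), by have := i.isLt; omega⟩)
    (hι'd : ∀ j : DIdx (n - 1), ι' (dg k (n - 1) j)
        = dg k n ⟨⟨(j.1 : ℕ), by have := j.1.isLt; omega⟩,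
            by have := j.2; simp only [Fin.val_mk]; omega⟩) :
    ∃ α : NH k n →ₗ[k] ((NH k (n + 1) ⊗[k] (NH k n ⊗[k] k)) ⧸ relM k n φ),
      (∀ a : NH k n,
        α a = Submodule.Quotient.mk ((1 : NH k (n + 1)) ⊗ₜ[k] (a ⊗ₜ[k] (1 : k)))) ∧
      Function.Injective α ∧
      (∀ s a s' : NH k n,
        (Submodule.Quotient.mk ((ι s) ⊗ₜ[k] ((a * s') ⊗ₜ[k] (1 : k)))
          : (NH k (n + 1) ⊗[k] (NH k n ⊗[k] k)) ⧸ relM k n φ)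
          = α (s * a * s')) ∧
      ∃ γ : ((NH k n ⊗[k] (NH k n ⊗[k] k)) ⧸ relN k n φ' ι') ≃ₗ[k]
          ((((NH k (n + 1) ⊗[k] (NH k n ⊗[k] k)) ⧸ relM k n φ)) ⧸ LinearMap.range α),
        ∀ (v w : NH k n) (c : k),
          γ (Submodule.Quotient.mk (v ⊗ₜ[k] (w ⊗ₜ[k] c)))
            = Submodule.Quotient.mk (Submodule.Quotient.mk
                ((ι v * dg k (n + 1)
                    ⟨⟨n - 1, by omega⟩, by simp only [Fin.val_mk]; omega⟩)
                  ⊗ₜ[k] (w ⊗ₜ[k] c))) := by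
  obtain ⟨m, rfl⟩ : ∃ m, n = m + 1 := ⟨n - 1, by omega⟩
  have hι : ι = nhEmb k (m + 1) := by
    refine nh_algHom_ext k (fun i hi => ?_) (fun i hi => ?_)
    · rw [nhEmb_nhX k hi, ← xg_eq_nhX k ⟨i, hi⟩, hιx, xg_eq_nhX]
      rfl
    · rw [nhEmb_nhD k hi, ← dg_eq_nhD k ⟨⟨i, by omega⟩, hi⟩, hιd, dg_eq_nhD]
      rfl
  have hι' : ι' = nhEmb k m := by
    refine nh_algHom_ext (N := m) k (fun i hi => ?_) (fun i hi => ?_)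
    · rw [nhEmb_nhX k hi, ← xg_eq_nhX k (⟨i, hi⟩ : Fin m)]
      exact (hι'x ⟨i, hi⟩).trans (xg_eq_nhX k _)
    · rw [nhEmb_nhD k hi, ← dg_eq_nhD k (⟨⟨i, by omega⟩, hi⟩ : DIdx m)]
      exact (hι'd ⟨⟨i, by omega⟩, hi⟩).trans (dg_eq_nhD k _)
  have hφ : ∀ a, φ (a ⊗ₜ 1) = nhEmb k (m + 1) a := by
    refine DFunLike.congr_fun (f := φ.comp Algebra.TensorProduct.includeLeft) ?_
    refine nh_algHom_ext k (fun i hi => ?_) (fun i hi => ?_)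
    · rw [nhEmb_nhX k hi, ← xg_eq_nhX k ⟨i, hi⟩]
      exact (hφx ⟨i, hi⟩).trans (xg_eq_nhX k _)
    · rw [nhEmb_nhD k hi, ← dg_eq_nhD k ⟨⟨i, by omega⟩, hi⟩]
      exact (hφd ⟨⟨i, by omega⟩, hi⟩).trans (dg_eq_nhD k _)
  have hφ' : ∀ a : NH k m, φ' (a ⊗ₜ 1) = nhEmb k m a := by
    refine DFunLike.congr_fun
      (f := AlgHom.comp (A := NH k m) φ' Algebra.TensorProduct.includeLeft) ?_
    refine nh_algHom_ext (N := m) k (fun i hi => ?_) (fun i hi => ?_)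
    · rw [nhEmb_nhX k hi, ← xg_eq_nhX k (⟨i, hi⟩ : Fin m)]
      exact (hφ'x ⟨i, hi⟩).trans (xg_eq_nhX k _)
    · rw [nhEmb_nhD k hi, ← dg_eq_nhD k (⟨⟨i, by omega⟩, hi⟩ : DIdx m)]
      exact (hφ'd ⟨⟨i, by omega⟩, hi⟩).trans (dg_eq_nhD k _)
  have hφt' := hφt.trans (xg_eq_nhX k _)
  have hφ't' := hφ't.trans (xg_eq_nhX k _)
  subst hι hι'
  refine ⟨relMUnit φ, relMUnit_apply φ, relMUnit_injective φ hφ hφt', fun s a s' => ?_,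
    relNEquivCokernel φ hφ hφt' φ' hφ' hφ't', fun v w c => ?_⟩
  · refine (relMUnit_smul_mul φ hφ s (a * s') 1).trans ?_
    rw [one_smul, mul_assoc]
  · rw [dg_eq_nhD]
    exact toCokernel_tmul φ v (w ⊗ₜ c)
end

section
/- Let k be a field and n, m ≥ 1. Let ψ_N be the anti-involution of NH_N fixing each generator, and set P_N := NH_N · ψ_N(e_N), a left NH_N-module. Then, disregarding gradings, there is an isomorphism of left NH_{n+m}-modules NH_{n+m} ⊗_{NH_n ⊗_k NH_m} (P_n ⊗_k P_m) ≅ P_{n+m}^{⊕ C(n+m,n)}, where NH_{n+m} is a right (NH_n ⊗_k NH_m)-module via φ and C(n+m,n) denotes the ordinary binomial coefficient (this is the ungraded form of the isomorphism IND(P_n ⊠ P_m) ≅ binom(n+m,n)_{q⁻²}·P_{n+m}). -/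
open scoped TensorProduct

variable (k : Type) [Field k]

/-- `IsDfam k N Dm` says that `Dm : S_N → NH_N` is the family `w ↦ ∂_w`, defined via
reduced expressions: it is characterized by `∂_1 = 1` together with
`∂_{w s_i} = ∂_w · ∂_i` whenever `ℓ(w s_i) = ℓ(w) + 1`, i.e. whenever `w(i) < w(i+1)`. -/
def IsDfam (N : ℕ) (Dm : Equiv.Perm (Fin N) → NH k N) : Prop :=
  Dm 1 = 1 ∧ ∀ (w : Equiv.Perm (Fin N)) (i : DIdx N),
    w i.1 < w i.succ → Dm (w * Equiv.swap i.1 i.succ) = Dm w * dg k N i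

/-- The element `e_N = x_1^{N-1} x_2^{N-2} ⋯ x_{N-1} ∂_{w_0} ∈ NH_N` (0-indexed:
`x_i` appears with exponent `N-1-i`), where `w_0 = Fin.revPerm` is the longest element
of `S_N` and `Dm = (∂_w)_w` is the family of divided difference elements. -/
noncomputable def eElt (N : ℕ) (Dm : Equiv.Perm (Fin N) → NH k N) : NH k N :=
  (List.ofFn fun i : Fin N => xg k N i ^ (N - 1 - (i : ℕ))).prod * Dm Fin.revPerm

/-- `IsPhi k n m φ` says that the `k`-algebra homomorphism
`φ : NH_n ⊗_k NH_m → NH_{n+m}` is the canonical one, with `φ(x_i ⊗ 1) = x_i`,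
`φ(∂_i ⊗ 1) = ∂_i`, `φ(1 ⊗ x_j) = x_{n+j}` and `φ(1 ⊗ ∂_j) = ∂_{n+j}`. -/
def IsPhi (n m : ℕ) (φ : NH k n ⊗[k] NH k m →ₐ[k] NH k (n + m)) : Prop :=
  (∀ i : Fin n, φ (xg k n i ⊗ₜ[k] 1) = xg k (n + m) (Fin.castAdd m i)) ∧
  (∀ j : DIdx n, φ (dg k n j ⊗ₜ[k] 1)
      = dg k (n + m) ⟨Fin.castAdd m j.1,
          by have := j.2; simp only [Fin.coe_castAdd]; omega⟩) ∧
  (∀ i : Fin m, φ ((1 : NH k n) ⊗ₜ[k] xg k m i) = xg k (n + m) (Fin.natAdd n i)) ∧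
  (∀ j : DIdx m, φ ((1 : NH k n) ⊗ₜ[k] dg k m j)
      = dg k (n + m) ⟨Fin.natAdd n j.1,
          by have := j.2; simp only [Fin.coe_natAdd]; omega⟩)

/-- `IsPsi k N ψ` says that the `k`-linear map `ψ : NH_N → NH_N` is the canonical
anti-automorphism: it is anti-multiplicative, unital, and fixes each generator. -/
def IsPsi (N : ℕ) (ψ : NH k N →ₗ[k] NH k N) : Prop :=
  (∀ a b : NH k N, ψ (a * b) = ψ b * ψ a) ∧ (ψ 1 = 1) ∧
  (∀ i : Fin N, ψ (xg k N i) = xg k N i) ∧ (∀ j : DIdx N, ψ (dg k N j) = dg k N j)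

/-- The left `NH_N`-module `P_N := NH_N · ψ_N(e_N)` (a left ideal of `NH_N`). -/
noncomputable def Pmod (N : ℕ) (ψ : NH k N →ₗ[k] NH k N)
    (Dm : Equiv.Perm (Fin N) → NH k N) : Type :=
  ↥(Submodule.span (NH k N) {ψ (eElt k N Dm)})

noncomputable instance (N : ℕ) (ψ : NH k N →ₗ[k] NH k N)
    (Dm : Equiv.Perm (Fin N) → NH k N) : AddCommGroup (Pmod k N ψ Dm) :=
  inferInstanceAs (AddCommGroup ↥(Submodule.span (NH k N) {ψ (eElt k N Dm)}))

noncomputable instance (N : ℕ) (ψ : NH k N →ₗ[k] NH k N)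
    (Dm : Equiv.Perm (Fin N) → NH k N) : Module (NH k N) (Pmod k N ψ Dm) :=
  inferInstanceAs (Module (NH k N) ↥(Submodule.span (NH k N) {ψ (eElt k N Dm)}))

noncomputable instance (N : ℕ) (ψ : NH k N →ₗ[k] NH k N)
    (Dm : Equiv.Perm (Fin N) → NH k N) : Module k (Pmod k N ψ Dm) :=
  inferInstanceAs (Module k ↥(Submodule.span (NH k N) {ψ (eElt k N Dm)}))

/-- The balancing relations defining `NH_{n+m} ⊗_{NH_n ⊗ NH_m} (P_n ⊗_k P_m)`:
`NH_{n+m}` is a right `(NH_n ⊗_k NH_m)`-module via `φ`, and `P_n ⊗_k P_m` carries the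
left `(NH_n ⊗_k NH_m)`-action by left multiplication on each factor. -/
noncomputable def indRelP (n m : ℕ)
    (φ : NH k n ⊗[k] NH k m →ₐ[k] NH k (n + m))
    (ψn : NH k n →ₗ[k] NH k n) (Dmn : Equiv.Perm (Fin n) → NH k n)
    (ψm : NH k m →ₗ[k] NH k m) (Dmm : Equiv.Perm (Fin m) → NH k m) :
    Submodule k (NH k (n + m) ⊗[k] (Pmod k n ψn Dmn ⊗[k] Pmod k m ψm Dmm)) :=
  Submodule.span k {z | ∃ (T : NH k (n + m)) (a : NH k n) (b : NH k m)
      (u : Pmod k n ψn Dmn) (v : Pmod k m ψm Dmm),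
    z = (T * φ (a ⊗ₜ[k] b)) ⊗ₜ[k] (u ⊗ₜ[k] v) - T ⊗ₜ[k] ((a • u) ⊗ₜ[k] (b • v))}

namespace NilHecke

section Basic

variable {k} {N : ℕ}

theorem xg_mul_xg (i j : Fin N) : xg k N i * xg k N j = xg k N j * xg k N i := by
  have := RingQuot.mkAlgHom_rel k (NHRel.xcomm (k := k) i j)
  simp only [map_mul] at this
  exact this

theorem dg_mul_dg_self (i : DIdx N) : dg k N i * dg k N i = 0 := by
  have := RingQuot.mkAlgHom_rel k (NHRel.dsq (k := k) i)
  simp only [map_mul, map_zero] at this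
  exact this

theorem dg_braid (i j : DIdx N) (h : (j.1 : ℕ) = (i.1 : ℕ) + 1) :
    dg k N i * dg k N j * dg k N i = dg k N j * dg k N i * dg k N j := by
  have := RingQuot.mkAlgHom_rel k (NHRel.braid (k := k) i j h)
  simp only [map_mul] at this
  exact this

theorem dg_mul_dg_comm (i j : DIdx N)
    (h : (i.1 : ℕ) + 1 < (j.1 : ℕ) ∨ (j.1 : ℕ) + 1 < (i.1 : ℕ)) :
    dg k N i * dg k N j = dg k N j * dg k N i := by
  have := RingQuot.mkAlgHom_rel k (NHRel.ddfar (k := k) i j h)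
  simp only [map_mul] at this
  exact this

theorem xg_mul_dg (i : DIdx N) :
    xg k N i.1 * dg k N i = dg k N i * xg k N i.succ + 1 := by
  have := RingQuot.mkAlgHom_rel k (NHRel.xd (k := k) i)
  simp only [map_mul, map_sub, map_one] at this
  exact sub_eq_iff_eq_add'.mp this

theorem dg_mul_xg (i : DIdx N) :
    dg k N i * xg k N i.1 = xg k N i.succ * dg k N i + 1 := by
  have := RingQuot.mkAlgHom_rel k (NHRel.dx (k := k) i)
  simp only [map_mul, map_sub, map_one] at this
  exact sub_eq_iff_eq_add'.mp this

theorem dg_mul_xg_succ (i : DIdx N) :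
    dg k N i * xg k N i.succ = xg k N i.1 * dg k N i - 1 := by
  rw [xg_mul_dg, add_sub_cancel_right]

/-- The commutation of `x_i` with `∂_{i+1}` is not among the defining relations
(there `|i - (i+1)| = 1`); it follows from the braid relation. -/
theorem commute_of_braid {R : Type*} [Ring R] {x₁ x₂ x₃ d₁ d₂ : R}
    (x₁₂ : x₁ * x₂ = x₂ * x₁) (x₁₃ : x₁ * x₃ = x₃ * x₁)
    (d₁₁ : d₁ * d₁ = 0) (d₂₂ : d₂ * d₂ = 0) (hb : d₁ * d₂ * d₁ = d₂ * d₁ * d₂)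
    (d₁x₁ : d₁ * x₁ = x₂ * d₁ + 1) (d₁x₂ : d₁ * x₂ = x₁ * d₁ - 1) (d₁x₃ : d₁ * x₃ = x₃ * d₁)
    (d₂x₂ : d₂ * x₂ = x₃ * d₂ + 1) (d₂x₃ : d₂ * x₃ = x₂ * d₂ - 1) : Commute d₂ x₁ := by
  have h₁ : d₂ * d₁ * (d₂ * x₁ - x₁ * d₂) = 0 := by
    have e₁ : d₂ * d₁ * (d₂ * x₁) = x₃ * (d₁ * d₂ * d₁) + d₁ * d₂ := by
      calc d₂ * d₁ * (d₂ * x₁) = d₁ * d₂ * (d₁ * x₁) := by rw [← mul_assoc, ← hb, mul_assoc]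
        _ = d₁ * (d₂ * x₂) * d₁ + d₁ * d₂ := by rw [d₁x₁]; noncomm_ring
        _ = (d₁ * x₃) * d₂ * d₁ + d₁ * d₁ + d₁ * d₂ := by rw [d₂x₂]; noncomm_ring
        _ = _ := by rw [d₁x₃, d₁₁]; noncomm_ring
    have e₂ : d₂ * d₁ * (x₁ * d₂) = x₃ * (d₂ * d₁ * d₂) + d₁ * d₂ := by
      calc d₂ * d₁ * (x₁ * d₂) = d₂ * (d₁ * x₁) * d₂ := by noncomm_ring
        _ = d₂ * x₂ * d₁ * d₂ + d₂ * d₂ := by rw [d₁x₁]; noncomm_ring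
        _ = _ := by rw [d₂x₂, d₂₂]; noncomm_ring
    rw [mul_sub, e₁, e₂, hb, sub_self]
  have c₃ : x₃ * (d₂ * x₁ - x₁ * d₂) = (d₂ * x₁ - x₁ * d₂) * x₂ := by
    have e : x₃ * d₂ = d₂ * x₂ - 1 := by rw [d₂x₂, add_sub_cancel_right]
    rw [mul_sub, ← mul_assoc, e, ← mul_assoc x₃, ← x₁₃, mul_assoc x₁ x₃, e]
    simp only [sub_mul, mul_sub, mul_assoc, x₁₂]
    noncomm_ring
  have c₂ : x₂ * (d₂ * x₁ - x₁ * d₂) = (d₂ * x₁ - x₁ * d₂) * x₃ := by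
    have e : x₂ * d₂ = d₂ * x₃ + 1 := by rw [d₂x₃, sub_add_cancel]
    rw [mul_sub, ← mul_assoc, e, ← mul_assoc x₂, ← x₁₂, mul_assoc x₁ x₂, e]
    simp only [sub_mul, mul_assoc, x₁₃]
    noncomm_ring
  generalize hc : d₂ * x₁ - x₁ * d₂ = c at h₁ c₂ c₃
  have h₂ : d₁ * c = 0 := by
    have e : d₂ * d₁ * (x₃ * c) = x₂ * (d₂ * d₁ * c) - d₁ * c := by
      calc d₂ * d₁ * (x₃ * c) = d₂ * (d₁ * x₃) * c := by noncomm_ring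
        _ = (d₂ * x₃) * d₁ * c := by rw [d₁x₃]; noncomm_ring
        _ = _ := by rw [d₂x₃]; noncomm_ring
    rw [c₃, ← mul_assoc, h₁, zero_mul, mul_zero, zero_sub] at e
    exact neg_eq_zero.mp e.symm
  have h₃ : c = 0 := by
    have e : d₁ * (x₂ * c) = x₁ * (d₁ * c) - c := by
      rw [← mul_assoc, d₁x₂]; noncomm_ring
    rw [c₂, ← mul_assoc, h₂, zero_mul, mul_zero, zero_sub] at e
    exact neg_eq_zero.mp e.symm
  exact sub_eq_zero.mp (hc.trans h₃)

theorem commute_dg_xg (i : Fin N) (j : DIdx N) (h : i ≠ j.1) (h' : i ≠ j.succ) :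
    Commute (dg k N j) (xg k N i) := by
  have h₁ : (i : ℕ) ≠ j.1 := fun e => h (Fin.ext e)
  have h₂ : (i : ℕ) ≠ (j.1 : ℕ) + 1 := fun e => h' (Fin.ext e)
  have far : ∀ (i : Fin N) (j : DIdx N),
      (i : ℕ) + 1 < (j.1 : ℕ) ∨ (j.1 : ℕ) + 1 < (i : ℕ) → Commute (dg k N j) (xg k N i) := by
    intro i j hi
    have := RingQuot.mkAlgHom_rel k (NHRel.xdfar (k := k) i j hi)
    simp only [map_mul] at this
    exact this.symm
  by_cases hi : (i : ℕ) + 1 < (j.1 : ℕ) ∨ (j.1 : ℕ) + 1 < (i : ℕ)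
  · exact far i j hi
  · have hij : (j.1 : ℕ) = i + 1 := by omega
    have hN := j.2
    let i' : DIdx N := ⟨i, by omega⟩
    have hj : i'.succ = j.1 := Fin.ext hij.symm
    refine commute_of_braid (x₂ := xg k N j.1) (x₃ := xg k N j.succ) (d₁ := dg k N i')
      (xg_mul_xg _ _) (xg_mul_xg _ _) (dg_mul_dg_self _) (dg_mul_dg_self _)
      (dg_braid i' j hij) ?_ ?_ ?_ (dg_mul_xg j) (dg_mul_xg_succ j)
    · rw [← hj]; exact dg_mul_xg i'
    · rw [← hj]; exact dg_mul_xg_succ i'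
    · exact far _ _ (Or.inr (by simp [i', hij]))

theorem adjoin_eq_top (S : Subalgebra k (NH k N)) (hx : ∀ i, xg k N i ∈ S)
    (hd : ∀ i, dg k N i ∈ S) (a : NH k N) : a ∈ S := by
  obtain ⟨a, rfl⟩ := RingQuot.mkAlgHom_surjective k (NHRel k N) a
  induction a using FreeAlgebra.induction with
  | grade0 r =>
    rw [AlgHom.commutes]
    exact S.algebraMap_mem r
  | grade1 x =>
    cases x with
    | inl i => exact hx i
    | inr i => exact hd i
  | mul a b ha hb =>
    rw [map_mul]
    exact S.mul_mem ha hb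
  | add a b ha hb =>
    rw [map_add]
    exact S.add_mem ha hb

open scoped IsMulCommutative in
theorem exists_polynomial_hom : ∃ f : MvPolynomial (Fin N) k →ₐ[k] NH k N,
    ∀ i, f (MvPolynomial.X i) = xg k N i := by
  have : IsMulCommutative (Algebra.adjoin k (Set.range (xg k N))) := by
    apply Algebra.isMulCommutative_adjoin
    rintro _ ⟨i, rfl⟩ _ ⟨j, rfl⟩
    exact xg_mul_xg i j
  let y : Fin N → Algebra.adjoin k (Set.range (xg k N)) :=
    fun i => ⟨xg k N i, Algebra.subset_adjoin ⟨i, rfl⟩⟩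
  exact ⟨(Subalgebra.val _).comp (MvPolynomial.aeval y), fun i => by simp [y]⟩

variable (k N) in
/-- The embedding of polynomials into the nilHecke algebra. -/
noncomputable def ev : MvPolynomial (Fin N) k →ₐ[k] NH k N :=
  exists_polynomial_hom.choose

@[simp]
theorem ev_X (i : Fin N) : ev k N (MvPolynomial.X i) = xg k N i :=
  exists_polynomial_hom.choose_spec i

theorem dg_mul_ev (i : DIdx N) (f : MvPolynomial (Fin N) k) :
    ∃ g h, dg k N i * ev k N f = ev k N g * dg k N i + ev k N h := by
  induction f using MvPolynomial.induction_on with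
  | C a =>
    refine ⟨MvPolynomial.C a, 0, ?_⟩
    rw [map_zero, add_zero, ← MvPolynomial.algebraMap_eq, AlgHom.commutes, Algebra.commutes]
  | add p q hp hq =>
    obtain ⟨g, h, e⟩ := hp
    obtain ⟨g', h', e'⟩ := hq
    refine ⟨g + g', h + h', ?_⟩
    simp only [map_add, mul_add, e, e', add_mul]
    abel
  | mul_X p j hp =>
    obtain ⟨g, h, e⟩ := hp
    rw [map_mul, ← mul_assoc, e, add_mul, ev_X, mul_assoc]
    by_cases h₁ : j = i.1
    · subst h₁
      refine ⟨g * MvPolynomial.X i.succ, g + h * MvPolynomial.X i.1, ?_⟩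
      rw [dg_mul_xg]
      simp only [map_add, map_mul, ev_X]
      noncomm_ring
    by_cases h₂ : j = i.succ
    · subst h₂
      refine ⟨g * MvPolynomial.X i.1, h * MvPolynomial.X i.succ - g, ?_⟩
      rw [dg_mul_xg_succ]
      simp only [map_sub, map_mul, ev_X]
      noncomm_ring
    · refine ⟨g * MvPolynomial.X j, h * MvPolynomial.X j, ?_⟩
      rw [(commute_dg_xg j i h₁ h₂).eq]
      simp only [map_mul, ev_X, mul_assoc]

variable (k N) in
/-- The left ideal generated by the `∂_i`. -/
noncomputable def dIdeal : Submodule (NH k N) (NH k N) :=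
  Submodule.span (NH k N) (Set.range (dg k N))

theorem mul_dg_mem_dIdeal (a : NH k N) (i : DIdx N) : a * dg k N i ∈ dIdeal k N :=
  Submodule.smul_mem _ a (Submodule.subset_span ⟨i, rfl⟩)

/-- If all `∂_i` annihilate `u` from the left then `NH · u` is the set of polynomial multiples
of `u`. -/
theorem exists_ev_mul_of_mem_span {u : NH k N} (hu : ∀ i, dg k N i * u = 0) {p : NH k N}
    (hp : p ∈ Submodule.span (NH k N) {u}) : ∃ f, p = ev k N f * u := by
  obtain ⟨a, rfl⟩ := Submodule.mem_span_singleton.mp hp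
  let S : Subalgebra k (NH k N) :=
    { carrier := {a | ∀ f, ∃ g, a * (ev k N f * u) = ev k N g * u}
      mul_mem' := by
        intro a b ha hb f
        obtain ⟨g, hg⟩ := hb f
        obtain ⟨h, hh⟩ := ha g
        exact ⟨h, by rw [mul_assoc, hg, hh]⟩
      add_mem' := by
        intro a b ha hb f
        obtain ⟨g, hg⟩ := hb f
        obtain ⟨h, hh⟩ := ha f
        exact ⟨h + g, by rw [add_mul, hg, hh, map_add, add_mul]⟩
      algebraMap_mem' := by
        intro r f
        refine ⟨MvPolynomial.C r * f, ?_⟩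
        rw [map_mul, ← MvPolynomial.algebraMap_eq, AlgHom.commutes, mul_assoc] }
  have ha : a ∈ S := by
    apply adjoin_eq_top
    · intro i f
      exact ⟨MvPolynomial.X i * f, by rw [map_mul, ev_X, mul_assoc]⟩
    · intro i f
      obtain ⟨g, h, e⟩ := dg_mul_ev i f
      exact ⟨h, by rw [← mul_assoc, e, add_mul, mul_assoc, hu, mul_zero, zero_add]⟩
  obtain ⟨g, hg⟩ := ha 1
  exact ⟨g, by rw [smul_eq_mul, ← hg, map_one, one_mul]⟩

end Basic

section Code

variable {N : ℕ}

/-- The number of positions `j > i` at which the value of `w` exceeds `w i`. -/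
def code (w : Equiv.Perm (Fin N)) (i : Fin N) : ℕ :=
  (Finset.univ.filter fun j => i < j ∧ w i < w j).card

theorem DIdx.swap_val (i : DIdx N) (l : Fin N) :
    ((Equiv.swap i.1 i.succ l : Fin N) : ℕ) =
      if (l : ℕ) = i.1 then (i.1 : ℕ) + 1
      else if (l : ℕ) = (i.1 : ℕ) + 1 then (i.1 : ℕ) else l := by
  rw [Equiv.swap_apply_def]
  simp only [Fin.ext_iff]
  split_ifs <;> rfl

theorem code_mul_swap (w : Equiv.Perm (Fin N)) (i : DIdx N) (h : w i.1 < w i.succ)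
    (hc : code w i.1 = code w i.succ + 1) :
    code (w * Equiv.swap i.1 i.succ) = Function.update (code w) i.1 (code w i.succ) := by
  have key : ∀ j, code (w * Equiv.swap i.1 i.succ) j = (Finset.univ.filter fun l =>
      j < Equiv.swap i.1 i.succ l ∧ w (Equiv.swap i.1 i.succ j) < w l).card := by
    intro j
    rw [code]
    refine Finset.card_equiv (Equiv.swap i.1 i.succ) fun l => ?_
    simp only [Finset.mem_filter, Finset.mem_univ, true_and, Equiv.swap_apply_self,
      Equiv.Perm.mul_apply]
    exact Finset.mem_filter.trans (and_iff_right (Finset.mem_univ _))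
  funext j
  by_cases h₁ : j = i.1
  · subst h₁
    rw [Function.update_self, key, code]
    congr 1
    ext l
    simp only [Finset.mem_filter, Finset.mem_univ, true_and, Equiv.swap_apply_left, Fin.lt_def,
      DIdx.swap_val]
    refine and_congr_left fun hl => ?_
    have : (l : ℕ) ≠ i.1 := fun e => by
      rw [Fin.ext e] at hl
      exact absurd h (not_lt.mpr (le_of_lt hl))
    rw [if_neg this]
    split_ifs <;> omega
  rw [Function.update_of_ne h₁]
  by_cases h₂ : j = i.succ
  · subst h₂
    have : (Finset.univ.filter fun l => i.succ < Equiv.swap i.1 i.succ l ∧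
        w (Equiv.swap i.1 i.succ i.succ) < w l) =
        (Finset.univ.filter fun j => i.1 < j ∧ w i.1 < w j).erase i.succ := by
      ext l
      simp only [Finset.mem_filter, Finset.mem_univ, true_and, Equiv.swap_apply_right, Fin.lt_def,
        DIdx.swap_val, Finset.mem_erase, ← and_assoc, ne_eq, Fin.ext_iff]
      refine and_congr_left fun hl => ?_
      split_ifs <;> omega
    rw [key, this, Finset.card_erase_of_mem (by
      simp only [Finset.mem_filter, Finset.mem_univ, true_and]
      exact ⟨Fin.lt_def.mpr (Nat.lt_succ_self _), h⟩)]
    change code w i.1 - 1 = _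
    omega
  · rw [key, Equiv.swap_apply_of_ne_of_ne h₁ h₂, code]
    congr 1
    ext l
    simp only [Finset.mem_filter, Finset.mem_univ, true_and, Fin.lt_def, DIdx.swap_val]
    refine and_congr_left fun hl => ?_
    simp only [Fin.ext_iff] at h₁ h₂
    split_ifs <;> omega

theorem lt_of_code_eq_succ {w : Equiv.Perm (Fin N)} {i : DIdx N}
    (hc : code w i.1 = code w i.succ + 1) : w i.1 < w i.succ := by
  by_contra h
  have : code w i.1 ≤ code w i.succ := by
    refine Finset.card_le_card fun l => ?_
    simp only [Finset.mem_filter, Finset.mem_univ, true_and]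
    rintro ⟨h₁, h₂⟩
    have hl : l ≠ i.succ := fun e => h (e ▸ h₂)
    simp only [ne_eq, Fin.ext_iff] at hl
    exact ⟨Fin.lt_def.mpr (by rw [Fin.lt_def] at h₁; simp only; omega),
      lt_of_le_of_lt (not_lt.mp h) h₂⟩
  omega

theorem code_one (i : Fin N) : code (1 : Equiv.Perm (Fin N)) i = N - 1 - i := by
  have : (Finset.univ.filter fun j => i < j) = Finset.Ioi i := by
    ext; simp
  simp [code, this]

theorem code_revPerm (i : Fin N) : code (Fin.revPerm : Equiv.Perm (Fin N)) i = 0 := by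
  simp only [code, Finset.card_eq_zero, Finset.filter_eq_empty_iff]
  rintro j - ⟨h₁, h₂⟩
  simp only [Fin.revPerm_apply, Fin.rev_lt_rev] at h₂
  exact lt_asymm h₁ h₂

theorem eq_revPerm_of_code_eq_zero {w : Equiv.Perm (Fin N)} (h : ∀ i, code w i = 0) :
    w = Fin.revPerm := by
  have anti : StrictAnti w := by
    intro i j hij
    have hi := h i
    simp only [code, Finset.card_eq_zero, Finset.filter_eq_empty_iff] at hi
    have := hi (Finset.mem_univ j)
    have hne : w i ≠ w j := fun e => hij.ne (w.injective e)
    simp only [hij, true_and, not_lt] at this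
    exact lt_of_le_of_ne this hne.symm
  have : (w : Fin N → Fin N) ∘ Fin.rev = id := by
    refine StrictMono.range_inj (fun i j hij => anti (Fin.rev_lt_rev.mpr hij)) strictMono_id
      |>.mp ?_
    rw [Set.range_id, Set.range_eq_univ]
    exact w.surjective.comp Fin.rev_surjective
  ext i : 1
  have := congrFun this (Fin.rev i)
  simpa using this

/-- The permutations reached from the identity by descending to the longest element along
codes whose consecutive entries drop by at most one. -/
theorem code_induction {P : Equiv.Perm (Fin N) → Prop} (one : P 1)
    (step : ∀ (w : Equiv.Perm (Fin N)) (i : DIdx N), w i.1 < w i.succ →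
      code w i.1 = code w i.succ + 1 → P w → P (w * Equiv.swap i.1 i.succ)) :
    P Fin.revPerm := by
  suffices H : ∀ (s : ℕ) (w : Equiv.Perm (Fin N)), ∑ i, code w i = s →
      (∀ i : DIdx N, code w i.1 = code w i.succ ∨ code w i.1 = code w i.succ + 1) → P w →
      P Fin.revPerm by
    refine H _ 1 rfl (fun i => ?_) one
    have := i.2
    simp only [code_one]
    omega
  intro s
  induction s using Nat.strong_induction_on with
  | _ s ih =>
    intro w hs hw hP
    by_cases hex : ∃ i : DIdx N, code w i.1 = code w i.succ + 1
    · obtain ⟨i, hi, hmin⟩ := (measure fun i : DIdx N => (i.1 : ℕ)).wf.has_min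
        {i : DIdx N | code w i.1 = code w i.succ + 1} hex
      have hlt := lt_of_code_eq_succ hi
      have hc := code_mul_swap w i hlt hi
      refine ih _ ?_ (w * Equiv.swap i.1 i.succ) rfl ?_ (step w i hlt hi hP)
      · rw [← hs, hc]
        replace hi : code w i.1 = code w i.succ + 1 := hi
        refine Finset.sum_lt_sum (fun j _ => ?_) ⟨i.1, Finset.mem_univ _, ?_⟩
        · by_cases hj : j = i.1
          · subst hj
            simp only [Function.update_self]
            omega
          · rw [Function.update_of_ne hj]
        · rw [Function.update_self]
          omega
      · intro j
        have hi' : code w i.1 = code w i.succ + 1 := hi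
        have hsi : i.succ ≠ i.1 := by simp [Fin.ext_iff]
        rw [hc]
        by_cases h₁ : j = i
        · subst h₁
          left
          rw [Function.update_self, Function.update_of_ne hsi]
        have h₁' : j.1 ≠ i.1 := fun e => h₁ (Subtype.ext e)
        rw [Function.update_of_ne h₁']
        by_cases h₂ : j.succ = i.1
        · rw [h₂, Function.update_self]
          have hj := hw j
          have := hmin j
          rw [h₂] at hj
          have hne : ¬ code w j.1 = code w j.succ + 1 := fun e =>
            hmin j e (by
              change (j.1 : ℕ) < i.1
              rw [← h₂]
              exact Nat.lt_succ_self _)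
          rw [h₂] at hne
          omega
        · rw [Function.update_of_ne h₂]
          exact hw j
    · have h0 : ∀ (d : ℕ) (i : Fin N), (i : ℕ) + d + 1 = N → code w i = 0 := by
        intro d
        induction d with
        | zero =>
          intro i hi
          simp only [code, Finset.card_eq_zero, Finset.filter_eq_empty_iff]
          rintro j - ⟨h₁, -⟩
          rw [Fin.lt_def] at h₁
          omega
        | succ d ihd =>
          intro i hi
          let i' : DIdx N := ⟨i, by omega⟩
          rcases hw i' with h | h
          · exact h.trans (ihd i'.succ (by simp only [i']; omega))
          · exact absurd ⟨i', h⟩ hex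
      rwa [eq_revPerm_of_code_eq_zero fun i => h0 (N - 1 - i) i (by omega)] at hP

end Code

section Idempotent

variable {k} {N : ℕ}

theorem dg_mul_ev_monomial (c : Fin N → ℕ) (i : DIdx N) (h : c i.1 = c i.succ + 1) :
    dg k N i * ev k N (∏ j, MvPolynomial.X j ^ c j) -
      ev k N (∏ j, MvPolynomial.X j ^ Function.update c i.1 (c i.succ) j) ∈ dIdeal k N := by
  have hsi : i.succ ≠ i.1 := by simp [Fin.ext_iff]
  set y : MvPolynomial (Fin N) k := ∏ j, MvPolynomial.X j ^ Function.update c i.1 (c i.succ) j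
    with hy
  have h₁ : ∏ j, MvPolynomial.X j ^ c j = MvPolynomial.X i.1 * y := by
    rw [hy, ← Finset.mul_prod_erase Finset.univ _ (Finset.mem_univ i.1),
      ← Finset.mul_prod_erase Finset.univ (fun j => _ ^ Function.update c i.1 (c i.succ) j)
        (Finset.mem_univ i.1), Function.update_self, h, pow_succ', mul_assoc]
    congr 2
    refine Finset.prod_congr rfl fun j hj => ?_
    rw [Function.update_of_ne (Finset.ne_of_mem_erase hj)]
  have h₂ : Commute (dg k N i) (ev k N y) := by
    let S : Submonoid (MvPolynomial (Fin N) k) :=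
      (Submonoid.centralizer {dg k N i}).comap (ev k N : MvPolynomial (Fin N) k →* NH k N)
    have hS : ∀ f, f ∈ S ↔ Commute (dg k N i) (ev k N f) := by
      intro f
      simp [S, Submonoid.mem_centralizer_iff, Commute, SemiconjBy]
    rw [← hS, hy, ← Finset.mul_prod_erase Finset.univ _ (Finset.mem_univ i.1),
      ← Finset.mul_prod_erase _ _ (Finset.mem_erase.mpr ⟨hsi, Finset.mem_univ i.succ⟩),
      Function.update_self, Function.update_of_ne hsi, ← mul_assoc, ← mul_pow]
    refine S.mul_mem (S.pow_mem ?_ _) (S.prod_mem fun j hj => S.pow_mem ?_ _)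
    · rw [hS, map_mul, ev_X, ev_X]
      change dg k N i * _ = _ * dg k N i
      rw [← mul_assoc, dg_mul_xg, add_mul, mul_assoc, dg_mul_xg_succ, xg_mul_xg i.1]
      noncomm_ring
    · rw [hS, ev_X]
      simp only [Finset.mem_erase] at hj
      exact commute_dg_xg j i hj.2.1 hj.1
  have : dg k N i * ev k N (MvPolynomial.X i.1 * y) - ev k N y =
      xg k N i.succ * ev k N y * dg k N i := by
    rw [map_mul, ev_X, ← mul_assoc, dg_mul_xg, add_mul, one_mul, add_sub_cancel_right,
      mul_assoc, h₂.eq, mul_assoc]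
  rw [h₁, this]
  exact mul_dg_mem_dIdeal _ _

variable {ψ : NH k N →ₗ[k] NH k N} {Dm : Equiv.Perm (Fin N) → NH k N}

theorem psi_ev (hψ : IsPsi k N ψ) (f : MvPolynomial (Fin N) k) : ψ (ev k N f) = ev k N f := by
  obtain ⟨hm, h1, hx, -⟩ := hψ
  induction f using MvPolynomial.induction_on with
  | C a =>
    rw [← MvPolynomial.algebraMap_eq, AlgHom.commutes, Algebra.algebraMap_eq_smul_one, map_smul, h1]
  | add p q hp hq => rw [map_add, map_add, hp, hq]
  | mul_X p i hp => rw [map_mul, hm, hp, ev_X, hx, ← ev_X, ← map_mul, mul_comm, map_mul]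

theorem psi_eElt (hψ : IsPsi k N ψ) : ψ (eElt k N Dm) =
    ψ (Dm Fin.revPerm) * ev k N (∏ j, MvPolynomial.X j ^ code (1 : Equiv.Perm (Fin N)) j) := by
  have : (List.ofFn fun i : Fin N => xg k N i ^ (N - 1 - (i : ℕ))).prod =
      ev k N (∏ j, MvPolynomial.X j ^ code (1 : Equiv.Perm (Fin N)) j) := by
    rw [← List.prod_ofFn, map_list_prod, List.map_ofFn]
    congr 2
    funext i
    simp [code_one]
  rw [eElt, hψ.1, this, psi_ev hψ]

theorem dg_mul_psi_eElt (hψ : IsPsi k N ψ) (hDm : IsDfam k N Dm) (i : DIdx N) :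
    dg k N i * ψ (eElt k N Dm) = 0 := by
  have h : Dm Fin.revPerm = Dm (Fin.revPerm * Equiv.swap i.1 i.succ) * dg k N i := by
    rw [← hDm.2]
    · rw [mul_assoc, Equiv.swap_mul_self, mul_one]
    · have := i.2
      simp only [Equiv.Perm.mul_apply, Equiv.swap_apply_left, Equiv.swap_apply_right,
        Fin.revPerm_apply]
      exact Fin.rev_lt_rev.mpr (Nat.lt_succ_self _)
  rw [psi_eElt hψ, ← mul_assoc, h, hψ.1, hψ.2.2.2, ← mul_assoc, dg_mul_dg_self, zero_mul, zero_mul]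

theorem psi_eElt_sub_one_mem (hψ : IsPsi k N ψ) (hDm : IsDfam k N Dm) :
    ψ (eElt k N Dm) - 1 ∈ dIdeal k N := by
  have := code_induction (N := N) (P := fun w => ψ (Dm w) *
      ev k N (∏ j, MvPolynomial.X j ^ code (1 : Equiv.Perm (Fin N)) j) -
      ev k N (∏ j, MvPolynomial.X j ^ code w j) ∈ dIdeal k N)
    (by simp [hDm.1, hψ.2.1]) (by
      intro w i hlt hc h
      rw [hDm.2 w i hlt, hψ.1, hψ.2.2.2, code_mul_swap w i hlt hc]
      have := add_mem (Submodule.smul_mem _ (dg k N i) h) (dg_mul_ev_monomial (k := k) _ i hc)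
      rwa [smul_eq_mul, mul_sub, sub_add_sub_cancel, ← mul_assoc] at this)
  simpa [psi_eElt hψ, code_revPerm] using this

end Idempotent

section Representation

variable {k} {N : ℕ}

/-- The universal property of the nilHecke algebra. -/
noncomputable def lift {B : Type*} [Ring B] [Algebra k B] (x : Fin N → B) (d : DIdx N → B)
    (xx : ∀ i j, x i * x j = x j * x i) (dd : ∀ i, d i * d i = 0)
    (braid : ∀ i j : DIdx N, (j.1 : ℕ) = (i.1 : ℕ) + 1 → d i * d j * d i = d j * d i * d j)
    (ddfar : ∀ i j : DIdx N, (i.1 : ℕ) + 1 < (j.1 : ℕ) ∨ (j.1 : ℕ) + 1 < (i.1 : ℕ) →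
      d i * d j = d j * d i)
    (xdfar : ∀ (i : Fin N) (j : DIdx N), i ≠ j.1 → i ≠ j.succ → x i * d j = d j * x i)
    (xd : ∀ i : DIdx N, x i.1 * d i - d i * x i.succ = 1)
    (dx : ∀ i : DIdx N, d i * x i.1 - x i.succ * d i = 1) : NH k N →ₐ[k] B :=
  RingQuot.liftAlgHom k ⟨FreeAlgebra.lift k (Sum.elim x d), by
    intro a b h
    induction h with
    | xcomm i j => simpa using xx i j
    | dsq i => simpa using dd i
    | braid i j h => simpa using braid i j h
    | ddfar i j h => simpa using ddfar i j h
    | xdfar i j h =>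
      simpa using xdfar i j (fun e => by subst e; omega)
        (fun e => by subst e; simp only at h; omega)
    | xd i => simpa using xd i
    | dx i => simpa using dx i⟩

section lift_apply

variable {B : Type*} [Ring B] [Algebra k B] {x : Fin N → B} {d : DIdx N → B}
    {xx dd braid ddfar xdfar xd dx}

theorem lift_xg (i : Fin N) :
    lift (k := k) x d xx dd braid ddfar xdfar xd dx (xg k N i) = x i := by
  refine (RingQuot.liftAlgHom_mkAlgHom_apply k _ _ _).trans ?_
  simp

theorem lift_dg (i : DIdx N) :
    lift (k := k) x d xx dd braid ddfar xdfar xd dx (dg k N i) = d i := by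
  refine (RingQuot.liftAlgHom_mkAlgHom_apply k _ _ _).trans ?_
  simp

end lift_apply

variable (k N) in
/-- Rational functions in `N` variables. -/
abbrev RatFn : Type := FractionRing (MvPolynomial (Fin N) k)

/-- The variables as rational functions. -/
noncomputable def rx (i : Fin N) : RatFn k N := algebraMap (MvPolynomial (Fin N) k) _ (.X i)

theorem rx_sub_ne_zero {i j : Fin N} (h : i ≠ j) : (rx i - rx j : RatFn k N) ≠ 0 := by
  rw [sub_ne_zero, rx, rx]
  exact fun e => h (MvPolynomial.X_injective (IsFractionRing.injective _ _ e))

/-- Permutation of the variables. -/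
noncomputable def permVars (σ : Equiv.Perm (Fin N)) : RatFn k N ≃ₐ[k] RatFn k N :=
  IsFractionRing.fieldEquivOfAlgEquiv k (RatFn k N) (RatFn k N) (MvPolynomial.renameEquiv k σ)

theorem permVars_algebraMap (σ : Equiv.Perm (Fin N)) (p : MvPolynomial (Fin N) k) :
    permVars σ (algebraMap _ (RatFn k N) p) = algebraMap _ _ (MvPolynomial.rename σ p) :=
  IsFractionRing.fieldEquivOfAlgEquiv_algebraMap _ _ _ _ _

@[simp]
theorem permVars_rx (σ : Equiv.Perm (Fin N)) (i : Fin N) :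
    permVars σ (rx i : RatFn k N) = rx (σ i) := by
  rw [rx, permVars_algebraMap, MvPolynomial.rename_X, rx]

theorem permVars_mul (σ τ : Equiv.Perm (Fin N)) (f : RatFn k N) :
    permVars (σ * τ) f = permVars σ (permVars τ f) := by
  obtain ⟨a, b, -, rfl⟩ := IsFractionRing.div_surjective (A := MvPolynomial (Fin N) k) f
  simp only [map_div₀, permVars_algebraMap, MvPolynomial.rename_rename]
  rfl

theorem permVars_one (f : RatFn k N) : permVars 1 f = f := by
  obtain ⟨a, b, -, rfl⟩ := IsFractionRing.div_surjective (A := MvPolynomial (Fin N) k) f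
  simp [map_div₀, permVars_algebraMap]

/-- The swap of two variables. -/
noncomputable abbrev sw (p q : Fin N) : RatFn k N ≃ₐ[k] RatFn k N := permVars (Equiv.swap p q)

theorem sw_sw (p q : Fin N) (f : RatFn k N) : sw p q (sw p q f) = f := by
  rw [← permVars_mul, Equiv.swap_mul_self, permVars_one]

theorem swap_braid {p q r : Fin N} (hpq : p ≠ q) (hpr : p ≠ r) (hqr : q ≠ r) :
    Equiv.swap p q * Equiv.swap q r * Equiv.swap p q =
      Equiv.swap q r * Equiv.swap p q * Equiv.swap q r := by
  rw [Equiv.swap_mul_swap_mul_swap hpq hpr, Equiv.swap_comm p q, Equiv.swap_comm q r,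
    Equiv.swap_mul_swap_mul_swap hqr.symm hpr.symm, Equiv.swap_comm]

theorem sw_braid {p q r : Fin N} (hpq : p ≠ q) (hpr : p ≠ r) (hqr : q ≠ r) (f : RatFn k N) :
    sw p q (sw q r (sw p q f)) = sw q r (sw p q (sw q r f)) := by
  simp only [← permVars_mul, ← mul_assoc, swap_braid hpq hpr hqr]

variable (k N) in
/-- Functions on binary words with values in rational functions: the module induced from the
polynomial representation is realised inside it. -/
abbrev WordFn : Type := (Fin N → Bool) → RatFn k N

/-- Multiplication by a variable on `WordFn`. -/
noncomputable def xOp (i : Fin N) : Module.End k (WordFn k N) where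
  toFun m S := rx i * m S
  map_add' m m' := by ext S; simp [mul_add]
  map_smul' c m := by ext S; simp

/-- Action of a divided difference on `WordFn`. -/
noncomputable def dOp (p q : Fin N) : Module.End k (WordFn k N) where
  toFun m S := (m S - sw p q (m S)) / (rx p - rx q) +
    if S p = false ∧ S q = true then sw p q (m (S ∘ Equiv.swap p q)) else 0
  map_add' m m' := by
    ext S
    simp only [Pi.add_apply, map_add]
    split_ifs <;> ring
  map_smul' c m := by
    ext S
    simp only [Pi.smul_apply, map_smul, RingHom.id_apply, smul_add, smul_ite, smul_zero]
    rw [← smul_sub, smul_div_assoc]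

theorem xOp_apply (i : Fin N) (m : WordFn k N) (S : Fin N → Bool) : xOp i m S = rx i * m S := rfl

theorem dOp_apply (p q : Fin N) (m : WordFn k N) (S : Fin N → Bool) :
    dOp p q m S = (m S - sw p q (m S)) / (rx p - rx q) +
      if S p = false ∧ S q = true then sw p q (m (S ∘ Equiv.swap p q)) else 0 := rfl

theorem dOp_mul_self {p q : Fin N} (h : p ≠ q) :
    (dOp p q * dOp p q : Module.End k (WordFn k N)) = 0 := by
  refine LinearMap.ext fun m => funext fun S => ?_
  have h₁ := rx_sub_ne_zero (k := k) h
  have h₂ := rx_sub_ne_zero (k := k) h.symm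
  cases hp : S p <;> cases hq : S q <;>
  · simp only [Module.End.mul_apply, dOp_apply, hp, hq, map_div₀, map_sub, map_add, map_zero,
      permVars_rx, Equiv.swap_apply_left, Equiv.swap_apply_right, sw_sw, Function.comp_apply,
      LinearMap.zero_apply, Pi.zero_apply, reduceCtorEq, and_self, and_true, and_false,
      if_true, if_false]
    field_simp
    ring

theorem dOp_braid {p q r : Fin N} (hpq : p ≠ q) (hpr : p ≠ r) (hqr : q ≠ r) :
    (dOp p q * dOp q r * dOp p q : Module.End k (WordFn k N)) = dOp q r * dOp p q * dOp q r := by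
  refine LinearMap.ext fun m => funext fun S => ?_
  have h₁ := rx_sub_ne_zero (k := k) hpq
  have h₂ := rx_sub_ne_zero (k := k) hpr
  have h₃ := rx_sub_ne_zero (k := k) hqr
  have h₄ := rx_sub_ne_zero (k := k) hpq.symm
  have h₅ := rx_sub_ne_zero (k := k) hpr.symm
  have h₆ := rx_sub_ne_zero (k := k) hqr.symm
  have e₁ : Equiv.swap p q r = r := Equiv.swap_apply_of_ne_of_ne hpr.symm hqr.symm
  have e₂ : Equiv.swap q r p = p := Equiv.swap_apply_of_ne_of_ne hpq hpr
  cases hp : S p <;> cases hq : S q <;> cases hr : S r <;>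
  · simp [dOp_apply, hp, hq, hr, e₁, e₂, map_div₀, sw_sw, sw_braid hpq hpr hqr]
    field_simp
    ring

theorem dOp_comm {p q r t : Fin N} (hpq : p ≠ q) (hrt : r ≠ t) (hpr : p ≠ r) (hpt : p ≠ t)
    (hqr : q ≠ r) (hqt : q ≠ t) : (dOp p q * dOp r t : Module.End k (WordFn k N)) = dOp r t * dOp p q := by
  refine LinearMap.ext fun m => funext fun S => ?_
  have e₁ : Equiv.swap p q r = r := Equiv.swap_apply_of_ne_of_ne hpr.symm hqr.symm
  have e₂ : Equiv.swap p q t = t := Equiv.swap_apply_of_ne_of_ne hpt.symm hqt.symm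
  have e₃ : Equiv.swap r t p = p := Equiv.swap_apply_of_ne_of_ne hpr hpt
  have e₄ : Equiv.swap r t q = q := Equiv.swap_apply_of_ne_of_ne hqr hqt
  have hd : Equiv.swap p q * Equiv.swap r t = Equiv.swap r t * Equiv.swap p q :=
    (Equiv.Perm.disjoint_swap_swap (by simp_all)).commute.eq
  have hs : ∀ f : RatFn k N, sw p q (sw r t f) = sw r t (sw p q f) := fun f => by
    simp only [← permVars_mul, hd]
  have hS : (S ∘ Equiv.swap p q) ∘ Equiv.swap r t = (S ∘ Equiv.swap r t) ∘ Equiv.swap p q := by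
    simp only [Function.comp_assoc, ← Equiv.Perm.coe_mul, hd]
  have h₁ : ∀ f g : RatFn k N, (f - g) / (rx p - rx q) = (f - g) * (rx p - rx q)⁻¹ :=
    fun f g => div_eq_mul_inv _ _
  simp only [Module.End.mul_apply, dOp_apply, map_div₀, map_add, map_sub, apply_ite, map_zero,
    permVars_rx, e₁, e₂, e₃, e₄, hs, hS, Function.comp_apply]
  split_ifs <;> ring

theorem xOp_mul_dOp_comm {p q r : Fin N} (hp : r ≠ p) (hq : r ≠ q) :
    (xOp r * dOp p q : Module.End k (WordFn k N)) = dOp p q * xOp r := by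
  refine LinearMap.ext fun m => funext fun S => ?_
  simp only [Module.End.mul_apply, dOp_apply, xOp_apply, map_mul, permVars_rx,
    Equiv.swap_apply_of_ne_of_ne hp hq]
  split_ifs <;> ring

theorem xOp_mul_dOp_sub {p q : Fin N} (h : p ≠ q) :
    (xOp p * dOp p q - dOp p q * xOp q : Module.End k (WordFn k N)) = 1 := by
  refine LinearMap.ext fun m => funext fun S => ?_
  have := rx_sub_ne_zero (k := k) h
  simp only [Module.End.mul_apply, LinearMap.sub_apply, Pi.sub_apply, Module.End.one_apply,
    dOp_apply, xOp_apply, map_mul, permVars_rx, Equiv.swap_apply_right]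
  split_ifs <;> field_simp <;> ring

theorem dOp_mul_xOp_sub {p q : Fin N} (h : p ≠ q) :
    (dOp p q * xOp p - xOp q * dOp p q : Module.End k (WordFn k N)) = 1 := by
  refine LinearMap.ext fun m => funext fun S => ?_
  have := rx_sub_ne_zero (k := k) h
  simp only [Module.End.mul_apply, LinearMap.sub_apply, Pi.sub_apply, Module.End.one_apply,
    dOp_apply, xOp_apply, map_mul, permVars_rx, Equiv.swap_apply_left]
  split_ifs <;> field_simp <;> ring

theorem DIdx.ne_succ (i : DIdx N) : i.1 ≠ i.succ := by simp [Fin.ext_iff]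

variable (k N) in
/-- The action of the nilHecke algebra on `WordFn`. -/
noncomputable def rho : NH k N →ₐ[k] Module.End k (WordFn k N) :=
  lift xOp (fun i => dOp i.1 i.succ)
    (fun i j => LinearMap.ext fun m => funext fun S => mul_left_comm (rx i) (rx j) (m S))
    (fun i => dOp_mul_self (DIdx.ne_succ i))
    (fun i j h => by
      have : j.1 = i.succ := Fin.ext h
      rw [this]
      refine dOp_braid (DIdx.ne_succ i) ?_ (this ▸ DIdx.ne_succ j)
      simp only [ne_eq, Fin.ext_iff]
      omega)
    (fun i j h => by
      refine dOp_comm (DIdx.ne_succ i) (DIdx.ne_succ j) ?_ ?_ ?_ ?_ <;>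
      · simp only [ne_eq, Fin.ext_iff]
        omega)
    (fun i j => xOp_mul_dOp_comm)
    (fun i => xOp_mul_dOp_sub (DIdx.ne_succ i))
    (fun i => dOp_mul_xOp_sub (DIdx.ne_succ i))

theorem rho_xg (i : Fin N) : rho k N (xg k N i) = xOp i := lift_xg i

theorem rho_dg (i : DIdx N) : rho k N (dg k N i) = dOp i.1 i.succ := lift_dg i

theorem rho_ev (f : MvPolynomial (Fin N) k) (m : WordFn k N) (S : Fin N → Bool) :
    rho k N (ev k N f) m S = algebraMap _ (RatFn k N) f * m S := by
  induction f using MvPolynomial.induction_on generalizing m with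
  | C a =>
    rw [← MvPolynomial.algebraMap_eq, AlgHom.commutes, AlgHom.commutes,
      ← IsScalarTower.algebraMap_apply, Module.algebraMap_end_apply, Pi.smul_apply,
      Algebra.smul_def]
  | add p q hp hq => simp only [map_add, LinearMap.add_apply, Pi.add_apply, hp, hq, add_mul]
  | mul_X p i hp =>
    rw [map_mul, map_mul, Module.End.mul_apply, hp, ev_X, rho_xg, xOp_apply, map_mul, mul_assoc]
    rfl

end Representation

section Filtration

variable {k} {N : ℕ}

/-- The sum of the positions of the letters `true`. -/
def wlen (S : Fin N → Bool) : ℕ := ∑ i, if S i then (i : ℕ) else 0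

theorem wlen_comp_swap {S : Fin N → Bool} {i : DIdx N} (h : S i.1 = false) (h' : S i.succ = true) :
    wlen (S ∘ Equiv.swap i.1 i.succ) + 1 = wlen S := by
  have e : wlen (S ∘ Equiv.swap i.1 i.succ) =
      ∑ j, if S j then ((Equiv.swap i.1 i.succ j : Fin N) : ℕ) else 0 := by
    rw [wlen, ← Equiv.sum_comp (Equiv.swap i.1 i.succ)]
    simp
  rw [e, wlen, ← Finset.add_sum_erase _ _ (Finset.mem_univ i.succ),
    ← Finset.add_sum_erase _ _ (Finset.mem_univ i.succ)]
  have : ∀ j ∈ Finset.univ.erase i.succ,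
      (if S j then ((Equiv.swap i.1 i.succ j : Fin N) : ℕ) else 0) =
        if S j then (j : ℕ) else 0 := by
    intro j hj
    by_cases hji : j = i.1
    · subst hji
      simp [h]
    · rw [Equiv.swap_apply_of_ne_of_ne hji (Finset.ne_of_mem_erase hj)]
  rw [Finset.sum_congr rfl this]
  simp only [h', Equiv.swap_apply_right, if_true]
  omega

variable (k N) in
/-- Functions supported on words of length at least `l`. -/
def wordFil (l : ℕ) : Submodule k (WordFn k N) where
  carrier := {m | ∀ S, wlen S < l → m S = 0}
  add_mem' hm hm' S hS := by simp [hm S hS, hm' S hS]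
  zero_mem' S hS := rfl
  smul_mem' c m hm S hS := by simp [hm S hS]

theorem rho_mem_wordFil {l : ℕ} (a : NH k N) {m : WordFn k N} (hm : m ∈ wordFil k N l) :
    rho k N a m ∈ wordFil k N l := by
  let T : Subalgebra k (NH k N) :=
    { carrier := {a | ∀ m ∈ wordFil k N l, rho k N a m ∈ wordFil k N l}
      mul_mem' := fun {a b} ha hb m hm => by
        rw [map_mul]
        exact ha _ (hb m hm)
      add_mem' := fun {a b} ha hb m hm => by
        rw [map_add]
        exact add_mem (ha m hm) (hb m hm)
      algebraMap_mem' := fun r m hm => by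
        rw [AlgHom.commutes, Module.algebraMap_end_apply]
        exact Submodule.smul_mem _ r hm }
  refine adjoin_eq_top T ?_ ?_ a m hm
  · intro i m hm S hS
    rw [rho_xg, xOp_apply, hm S hS, mul_zero]
  · intro i m hm S hS
    rw [rho_dg, dOp_apply, hm S hS, map_zero, sub_zero, zero_div, zero_add]
    split_ifs with h
    · have := wlen_comp_swap h.1 h.2
      rw [hm _ (by omega), map_zero]
    · rfl

theorem rho_mem_wordFil_succ {l : ℕ} {a : NH k N} (ha : a ∈ dIdeal k N) {m : WordFn k N}
    (hm : m ∈ wordFil k N l) (hc : ∀ S, wlen S = l → ∃ c : k, m S = algebraMap k _ c) :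
    rho k N a m ∈ wordFil k N (l + 1) := by
  induction ha using Submodule.span_induction with
  | mem a ha =>
    obtain ⟨i, rfl⟩ := ha
    intro S hS
    have h0 : ∀ T, wlen T ≤ l → m T - sw i.1 i.succ (m T) = 0 := by
      intro T hT
      rcases hT.lt_or_eq with h | h
      · rw [hm T h, map_zero, sub_zero]
      · obtain ⟨c, e⟩ := hc T h
        rw [e, AlgEquiv.commutes, sub_self]
    rw [rho_dg, dOp_apply, h0 S (by omega), zero_div, zero_add]
    split_ifs with h
    · have := wlen_comp_swap h.1 h.2
      rw [hm _ (by omega), map_zero]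
    · rfl
  | zero => simp
  | add a b _ _ ha hb =>
    rw [map_add]
    exact add_mem ha hb
  | smul c a _ ha =>
    rw [smul_eq_mul, map_mul]
    exact rho_mem_wordFil c ha

variable (k) in
/-- The indicator function of a word. -/
noncomputable def wordSingle (S : Fin N → Bool) : WordFn k N := Pi.single S 1

theorem rho_dg_wordSingle_apply (S T : Fin N → Bool) (i : DIdx N) :
    rho k N (dg k N i) (wordSingle k S) T =
      if T i.1 = false ∧ T i.succ = true then
        wordSingle k S (T ∘ Equiv.swap i.1 i.succ) else 0 := by
  have h (T : Fin N → Bool) (σ : RatFn k N ≃ₐ[k] RatFn k N) :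
      σ (wordSingle k S T) = wordSingle k S T := by
    simp only [wordSingle, Pi.single_apply]
    split_ifs
    · exact map_one σ
    · exact map_zero σ
  rw [rho_dg, dOp_apply, h, h, sub_self, zero_div, zero_add]

theorem comp_swap_comp_swap (S : Fin N → Bool) (p q : Fin N) :
    (S ∘ Equiv.swap p q) ∘ Equiv.swap p q = S := by
  rw [Function.comp_assoc, ← Equiv.Perm.coe_mul, Equiv.swap_mul_self]
  rfl

theorem rho_dg_wordSingle_of_swap {S : Fin N → Bool} {i : DIdx N} (h : S i.1 = true)
    (h' : S i.succ = false) :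
    rho k N (dg k N i) (wordSingle k S) = wordSingle k (S ∘ Equiv.swap i.1 i.succ) := by
  ext T
  rw [rho_dg_wordSingle_apply]
  by_cases hT : T = S ∘ Equiv.swap i.1 i.succ
  · subst hT
    rw [if_pos (by simp [h, h']), comp_swap_comp_swap, wordSingle, wordSingle, Pi.single_eq_same,
      Pi.single_eq_same]
  · have : T ∘ Equiv.swap i.1 i.succ ≠ S := by
      rintro rfl
      exact hT (comp_swap_comp_swap _ _ _).symm
    rw [wordSingle, wordSingle, Pi.single_eq_of_ne hT, Pi.single_eq_of_ne this, ite_self]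

theorem rho_dg_wordSingle_eq_zero {S : Fin N → Bool} {i : DIdx N}
    (h : ¬ (S i.1 = true ∧ S i.succ = false)) : rho k N (dg k N i) (wordSingle k S) = 0 := by
  ext T
  rw [rho_dg_wordSingle_apply]
  split_ifs with hT
  · rw [wordSingle, Pi.single_eq_of_ne, Pi.zero_apply]
    rintro rfl
    exact h (by simp [hT])
  · rfl

theorem eq_zero_of_sum_rho_eq_zero {u : NH k N} (hu : u - 1 ∈ dIdeal k N) {ι : Type*} [Fintype ι]
    {W : ι → Fin N → Bool} (hW : Function.Injective W) {f : ι → MvPolynomial (Fin N) k}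
    (h : ∑ s, rho k N (ev k N (f s) * u) (wordSingle k (W s)) = 0) (s : ι) : f s = 0 := by
  have hfil : ∀ S : Fin N → Bool, wordSingle k S ∈ wordFil k N (wlen S) := by
    intro S T hT
    rw [wordSingle, Pi.single_eq_of_ne]
    rintro rfl
    exact lt_irrefl _ hT
  have hdiff : ∀ S T : Fin N → Bool, wlen T ≤ wlen S →
      rho k N u (wordSingle k S) T = wordSingle k S T := by
    intro S T hT
    have := rho_mem_wordFil_succ hu (hfil S) (fun T _ => ?_) T (by omega)
    · rwa [map_sub, map_one, LinearMap.sub_apply, Pi.sub_apply, Module.End.one_apply,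
        sub_eq_zero] at this
    · by_cases hST : T = S
      · subst hST
        exact ⟨1, by simp [wordSingle]⟩
      · exact ⟨0, by simp [wordSingle, Pi.single_eq_of_ne hST]⟩
  induction hl : wlen (W s) using Nat.strong_induction_on generalizing s with
  | _ l ih =>
    have hs := congrFun h (W s)
    rw [Finset.sum_apply, Finset.sum_eq_single s] at hs
    · rw [map_mul, Module.End.mul_apply, rho_ev, hdiff _ _ le_rfl, wordSingle, Pi.single_eq_same,
        mul_one] at hs
      exact (map_eq_zero_iff _ (IsFractionRing.injective _ _)).mp hs
    · intro t _ ht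
      rw [map_mul, Module.End.mul_apply, rho_ev]
      by_cases hlt : wlen (W t) < l
      · rw [ih _ hlt t rfl, map_zero, zero_mul]
      · rw [hdiff _ _ (by omega), wordSingle, Pi.single_eq_of_ne (hW.ne ht.symm), mul_zero]
    · simp

end Filtration

section Reach

variable {k} {N : ℕ}

/-- The number of letters `true`. -/
def numTrue (S : Fin N → Bool) : ℕ := (Finset.univ.filter fun i => S i = true).card

theorem numTrue_comp_perm (S : Fin N → Bool) (σ : Equiv.Perm (Fin N)) :
    numTrue (S ∘ σ) = numTrue S := by
  simp only [numTrue, Finset.card_filter]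
  exact Equiv.sum_comp σ fun i => if S i = true then 1 else 0

variable (N) in
/-- The word whose first `n` letters are `true`. -/
def baseWord (n : ℕ) : Fin N → Bool := fun j => decide (j.1 < n)

theorem numTrue_baseWord {n : ℕ} (h : n ≤ N) : numTrue (baseWord N n) = n := by
  simp only [numTrue, baseWord, decide_eq_true_eq]
  rw [Fin.card_filter_val_lt, min_eq_right h]

theorem exists_descent {n : ℕ} {S : Fin N → Bool} (hS : numTrue S = n) (h : S ≠ baseWord N n) :
    ∃ i : DIdx N, S i.1 = false ∧ S i.succ = true := by
  by_contra! H
  have mono : ∀ d (a b : Fin N), b.1 = a.1 + d → S b = true → S a = true := by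
    intro d
    induction d with
    | zero =>
      intro a b e hb
      rwa [Fin.ext (e : b.1 = a.1)] at hb
    | succ d ih =>
      intro a b e hb
      have hd : a.1 + d < N := by have := b.2; omega
      refine ih a ⟨a.1 + d, hd⟩ rfl ?_
      by_contra hc
      refine H ⟨⟨a.1 + d, hd⟩, ?_⟩ (by simpa using hc) ?_
      · simp only
        have := b.2
        omega
      · convert hb
        exact Fin.ext (by simp only; omega)
  refine h (funext fun j => ?_)
  rw [baseWord]
  cases hj : S j
  · have : numTrue S ≤ j.1 := by
      have e : (Finset.univ.filter fun i => S i = true) ⊆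
          Finset.univ.filter fun i : Fin N => i.1 < j.1 := by
        intro i
        simp only [Finset.mem_filter, Finset.mem_univ, true_and]
        intro hi
        by_contra hc
        rw [mono (i.1 - j.1) j i (by omega) hi] at hj
        exact absurd hj (by simp)
      refine (Finset.card_le_card e).trans ?_
      rw [Fin.card_filter_val_lt]
      exact min_le_right _ _
    symm
    rw [decide_eq_false_iff_not]
    omega
  · have : j.1 + 1 ≤ numTrue S := by
      have e : (Finset.univ.filter fun i : Fin N => i.1 < j.1 + 1) ⊆
          Finset.univ.filter fun i => S i = true := by
        intro i
        simp only [Finset.mem_filter, Finset.mem_univ, true_and]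
        intro hi
        exact mono (j.1 - i.1) i j (by omega) hj
      refine le_trans ?_ (Finset.card_le_card e)
      rw [Fin.card_filter_val_lt]
      exact le_min j.2 le_rfl
    symm
    rw [decide_eq_true_eq]
    omega

variable {M : Type*} [AddCommGroup M] [Module (NH k N) M]

variable (k) in
/-- `Reach k n g S m` says that `m` is obtained from `g` by applying divided differences along a
path of words from `baseWord N n` to `S` in which each step moves a letter `true` to the right. -/
inductive Reach (n : ℕ) (g : M) : (Fin N → Bool) → M → Prop
  | base : Reach n g (baseWord N n) g
  | step {S : Fin N → Bool} {m : M} (i : DIdx N) (h : Reach n g S m) (h₁ : S i.1 = true)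
      (h₂ : S i.succ = false) : Reach n g (S ∘ Equiv.swap i.1 i.succ) (dg k N i • m)

theorem Reach.step' {n : ℕ} {g : M} {S : Fin N → Bool} {m : M} {i : DIdx N}
    (h : Reach k n g (S ∘ Equiv.swap i.1 i.succ) m) (h₁ : S i.1 = false) (h₂ : S i.succ = true) :
    Reach k n g S (dg k N i • m) := by
  have := h.step i (by simpa using h₂) (by simpa using h₁)
  rwa [comp_swap_comp_swap] at this

theorem Reach.inv {n : ℕ} {g : M} {S : Fin N → Bool} {m : M} (h : Reach k n g S m) :
    (S = baseWord N n ∧ m = g) ∨ ∃ (i : DIdx N) (m' : M), S i.1 = false ∧ S i.succ = true ∧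
      m = dg k N i • m' ∧ Reach k n g (S ∘ Equiv.swap i.1 i.succ) m' := by
  cases h with
  | base => exact Or.inl ⟨rfl, rfl⟩
  | @step S m i h h₁ h₂ =>
    refine Or.inr ⟨i, m, by simpa using h₂, by simpa using h₁, rfl, ?_⟩
    rwa [comp_swap_comp_swap]

theorem baseWord_not_descent {n : ℕ} {i : DIdx N} (h₁ : baseWord N n i.1 = false)
    (h₂ : baseWord N n i.succ = true) : False := by
  simp only [baseWord, decide_eq_false_iff_not, decide_eq_true_eq] at h₁ h₂
  omega

theorem Reach.numTrue_eq {n : ℕ} {g : M} {S : Fin N → Bool} {m : M} (h : Reach k n g S m)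
    (hn : n ≤ N) : numTrue S = n := by
  induction h with
  | base => exact numTrue_baseWord hn
  | step i h h₁ h₂ ih => rwa [numTrue_comp_perm]

theorem exists_reach (n : ℕ) (g : M) {S : Fin N → Bool} (hS : numTrue S = n) :
    ∃ m, Reach k n g S m := by
  induction hl : wlen S using Nat.strong_induction_on generalizing S with
  | _ l ih =>
    by_cases h : S = baseWord N n
    · subst h
      exact ⟨g, .base⟩
    · obtain ⟨i, h₁, h₂⟩ := exists_descent hS h
      have := wlen_comp_swap h₁ h₂
      obtain ⟨m, hm⟩ := ih (wlen (S ∘ Equiv.swap i.1 i.succ)) (by omega)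
        ((numTrue_comp_perm S _).trans hS) rfl
      exact ⟨_, hm.step' h₁ h₂⟩

/-- Two indices are far apart. -/
def Far (i j : DIdx N) : Prop := (i.1 : ℕ) + 1 < (j.1 : ℕ) ∨ (j.1 : ℕ) + 1 < (i.1 : ℕ)

theorem Far.symm {i j : DIdx N} (h : Far i j) : Far j i := Or.symm h

theorem Far.swap_apply {i j : DIdx N} (h : Far i j) :
    Equiv.swap i.1 i.succ j.1 = j.1 ∧ Equiv.swap i.1 i.succ j.succ = j.succ := by
  unfold Far at h
  constructor <;>
  · refine Equiv.swap_apply_of_ne_of_ne ?_ ?_ <;>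
    · simp only [ne_eq, Fin.ext_iff]
      omega

theorem Far.comp_swap_comm {i j : DIdx N} (h : Far i j) (S : Fin N → Bool) :
    (S ∘ Equiv.swap i.1 i.succ) ∘ Equiv.swap j.1 j.succ =
      (S ∘ Equiv.swap j.1 j.succ) ∘ Equiv.swap i.1 i.succ := by
  have : Equiv.swap i.1 i.succ * Equiv.swap j.1 j.succ =
      Equiv.swap j.1 j.succ * Equiv.swap i.1 i.succ := by
    refine (Equiv.Perm.disjoint_swap_swap ?_).commute.eq
    unfold Far at h
    simp [Fin.ext_iff]
    omega
  simp only [Function.comp_assoc, ← Equiv.Perm.coe_mul, this]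

theorem Far.smul_comm {i j : DIdx N} (h : Far i j) (m : M) :
    dg k N i • dg k N j • m = dg k N j • dg k N i • m := by
  rw [← mul_smul, ← mul_smul, dg_mul_dg_comm i j h]

theorem Reach.unique {n : ℕ} (hn : n ≤ N) {g : M} {S : Fin N → Bool} {m m' : M}
    (h : Reach k n g S m) (h' : Reach k n g S m') : m = m' := by
  induction hl : wlen S using Nat.strong_induction_on generalizing S m m' with
  | _ l ih =>
    have hc := h.numTrue_eq hn
    rcases h.inv with ⟨rfl, rfl⟩ | ⟨i, m₁, hi₁, hi₂, rfl, hm₁⟩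
    · rcases h'.inv with ⟨-, rfl⟩ | ⟨j, m₂, hj₁, hj₂, rfl, hm₂⟩
      · rfl
      · exact (baseWord_not_descent hj₁ hj₂).elim
    · rcases h'.inv with ⟨rfl, rfl⟩ | ⟨j, m₂, hj₁, hj₂, rfl, hm₂⟩
      · exact (baseWord_not_descent hi₁ hi₂).elim
      · have li := wlen_comp_swap hi₁ hi₂
        have lj := wlen_comp_swap hj₁ hj₂
        by_cases hij : i = j
        · subst hij
          rw [ih _ (by omega) hm₁ hm₂ rfl]
        · have far : Far i j := by
            have h₁ : i.1.1 ≠ j.1.1 := fun e => hij (Subtype.ext (Fin.ext e))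
            have h₂ : i.1.1 + 1 ≠ j.1.1 := fun e => by
              rw [show i.succ = j.1 from Fin.ext e, hj₁] at hi₂
              exact absurd hi₂ (by simp)
            have h₃ : j.1.1 + 1 ≠ i.1.1 := fun e => by
              rw [show j.succ = i.1 from Fin.ext e, hi₁] at hj₂
              exact absurd hj₂ (by simp)
            unfold Far
            omega
          obtain ⟨m₃, hm₃⟩ := exists_reach (k := k) n g
            (S := (S ∘ Equiv.swap i.1 i.succ) ∘ Equiv.swap j.1 j.succ)
            (by rw [numTrue_comp_perm, numTrue_comp_perm, hc])
          have e₁ := ih _ (by omega) hm₁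
            (hm₃.step' (by simp [far.swap_apply, hj₁]) (by simp [far.swap_apply, hj₂])) rfl
          rw [far.comp_swap_comm] at hm₃
          have e₂ := ih _ (by omega) hm₂
            (hm₃.step' (by simp [far.symm.swap_apply, hi₁])
              (by simp [far.symm.swap_apply, hi₂])) rfl
          rw [e₁, e₂, far.smul_comm]

theorem Reach.exists_of_descent {n : ℕ} (hn : n ≤ N) {g : M} {S : Fin N → Bool} {m : M}
    (h : Reach k n g S m) {i : DIdx N} (h₁ : S i.1 = false) (h₂ : S i.succ = true) :
    ∃ m', m = dg k N i • m' ∧ Reach k n g (S ∘ Equiv.swap i.1 i.succ) m' := by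
  obtain ⟨m', hm'⟩ := exists_reach (k := k) n g (S := S ∘ Equiv.swap i.1 i.succ)
    ((numTrue_comp_perm S _).trans (h.numTrue_eq hn))
  exact ⟨m', h.unique hn (hm'.step' h₁ h₂), hm'⟩

theorem swap_apply_far_left {p q r : Fin N} (hp : r.1 ≠ p.1) (hq : r.1 ≠ q.1) :
    Equiv.swap p q r = r :=
  Equiv.swap_apply_of_ne_of_ne (fun e => hp (congrArg _ e)) (fun e => hq (congrArg _ e))

theorem Reach.dg_smul_eq_zero {n : ℕ} (hn : n ≤ N) {g : M}
    (hg : ∀ i : DIdx N, i.1.1 + 1 ≠ n → dg k N i • g = 0) {S : Fin N → Bool} {m : M}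
    (h : Reach k n g S m) {i : DIdx N} (hi : ¬ (S i.1 = true ∧ S i.succ = false)) :
    dg k N i • m = 0 := by
  induction hl : wlen S using Nat.strong_induction_on generalizing S m i with
  | _ l ih =>
    by_cases hd : S i.1 = false ∧ S i.succ = true
    · obtain ⟨m', rfl, -⟩ := h.exists_of_descent hn hd.1 hd.2
      rw [← mul_smul, dg_mul_dg_self, zero_smul]
    have heq : S i.1 = S i.succ := by
      cases h₁ : S i.1 <;> cases h₂ : S i.succ <;> simp_all
    rcases h.inv with ⟨rfl, rfl⟩ | ⟨j, m₁, hj₁, hj₂, rfl, hm₁⟩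
    · refine hg i fun e => ?_
      simp only [baseWord, decide_eq_decide] at heq
      omega
    have lj := wlen_comp_swap hj₁ hj₂
    have key (hadj : j.1.1 = i.1.1 + 1 ∨ i.1.1 = j.1.1 + 1)
        (hi' : (S ∘ Equiv.swap j.1 j.succ) i.1 = false)
        (hi'' : (S ∘ Equiv.swap j.1 j.succ) i.succ = true)
        (hjj : ((S ∘ Equiv.swap j.1 j.succ) ∘ Equiv.swap i.1 i.succ) j.1 =
          ((S ∘ Equiv.swap j.1 j.succ) ∘ Equiv.swap i.1 i.succ) j.succ) :
        dg k N i • dg k N j • m₁ = 0 := by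
      obtain ⟨m₂, rfl, hm₂⟩ := hm₁.exists_of_descent hn hi' hi''
      have li := wlen_comp_swap hi' hi''
      have h0 := ih _ (by omega) hm₂ (i := j) (by rw [hjj]; simp) rfl
      have br : dg k N i * dg k N j * dg k N i = dg k N j * dg k N i * dg k N j := by
        rcases hadj with e | e
        · exact dg_braid i j e
        · exact (dg_braid j i e).symm
      rw [← mul_smul, ← mul_smul, br, mul_smul, h0, smul_zero]
    by_cases e₁ : j.1.1 = i.1.1 + 1
    · obtain e : j.1 = i.succ := Fin.ext e₁
      have f₁ : Equiv.swap j.1 j.succ i.1 = i.1 := swap_apply_far_left (by omega) (by simp; omega)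
      have f₂ : Equiv.swap i.1 i.succ j.succ = j.succ :=
        swap_apply_far_left (by simp; omega) (by simp; omega)
      refine key (Or.inl e₁) ?_ ?_ ?_
      · rw [Function.comp_apply, f₁, heq, ← e, hj₁]
      · rw [← e, Function.comp_apply, Equiv.swap_apply_left, hj₂]
      · simp only [Function.comp_apply]
        rw [f₂, Equiv.swap_apply_right, hj₁, e, Equiv.swap_apply_right, ← e, f₁, heq, ← e, hj₁]
    by_cases e₂ : i.1.1 = j.1.1 + 1
    · obtain e : i.1 = j.succ := Fin.ext e₂
      have f₁ : Equiv.swap j.1 j.succ i.succ = i.succ :=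
        swap_apply_far_left (by simp; omega) (by simp; omega)
      have f₂ : Equiv.swap i.1 i.succ j.1 = j.1 :=
        swap_apply_far_left (by omega) (by simp; omega)
      refine key (Or.inr e₂) ?_ ?_ ?_
      · rw [e, Function.comp_apply, Equiv.swap_apply_right, hj₁]
      · rw [Function.comp_apply, f₁, ← heq, e, hj₂]
      · simp only [Function.comp_apply]
        rw [f₂, Equiv.swap_apply_left, hj₂, ← e, Equiv.swap_apply_left, e, f₁, ← heq, e, hj₂]
    · have hne : i.1.1 ≠ j.1.1 := fun e => by
        obtain rfl : i = j := Subtype.ext (Fin.ext e)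
        exact hd ⟨hj₁, hj₂⟩
      have far : Far j i := by
        unfold Far
        omega
      rw [far.symm.smul_comm, ih _ (by omega) hm₁ (by simp [far.swap_apply, heq]) rfl, smul_zero]

end Reach

section Decomposition

variable {k} {N : ℕ} {M : Type*} [AddCommGroup M] [Module (NH k N) M]

theorem wlen_le (S : Fin N → Bool) : wlen S ≤ ∑ i : Fin N, (i : ℕ) :=
  Finset.sum_le_sum fun i _ => by split_ifs <;> omega

theorem Reach.rho_apply {n : ℕ} {g : M} (β : M →ₗ[NH k N] NH k N)
    (hβ : rho k N (β g) (wordSingle k (baseWord N n)) = wordSingle k (baseWord N n))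
    {S : Fin N → Bool} {m : M} (h : Reach k n g S m) :
    rho k N (β m) (wordSingle k (baseWord N n)) = wordSingle k S := by
  induction h with
  | base => exact hβ
  | step i h h₁ h₂ ih =>
    rw [map_smul, smul_eq_mul, map_mul, Module.End.mul_apply, ih, rho_dg_wordSingle_of_swap h₁ h₂]

theorem Reach.mem_of_smul_mem {n : ℕ} (hn : n ≤ N) {g : M}
    (hg : ∀ i : DIdx N, i.1.1 + 1 ≠ n → dg k N i • g = 0) {u : NH k N} (hu : u - 1 ∈ dIdeal k N)
    {R : Submodule (NH k N) M} (hR : ∀ (S : Fin N → Bool) (m : M), Reach k n g S m → u • m ∈ R)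
    {S : Fin N → Bool} {m : M} (h : Reach k n g S m) : m ∈ R := by
  obtain ⟨d, hd⟩ : ∃ d, ∑ i : Fin N, (i : ℕ) < wlen S + d := 
    ⟨_, Nat.lt_add_left _ (Nat.lt_succ_self _)⟩
  induction d generalizing S m with
  | zero => exact absurd (wlen_le S) (by omega)
  | succ d ih =>
    have key : ∀ a ∈ dIdeal k N, a • m ∈ R := by
      intro a ha
      induction ha using Submodule.span_induction with
      | mem a ha =>
        obtain ⟨i, rfl⟩ := ha
        by_cases hi : S i.1 = true ∧ S i.succ = false
        · refine ih (h.step i hi.1 hi.2) ?_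
          have := wlen_comp_swap (S := S ∘ Equiv.swap i.1 i.succ) (i := i) (by simp [hi.2])
            (by simp [hi.1])
          rw [comp_swap_comp_swap] at this
          omega
        · rw [h.dg_smul_eq_zero hn hg hi]
          exact zero_mem R
      | zero => simp
      | add a b _ _ ha hb =>
        rw [add_smul]
        exact add_mem ha hb
      | smul c a _ ha =>
        rw [smul_eq_mul, mul_smul]
        exact R.smul_mem c ha
    have := sub_mem (hR S m h) (key _ hu)
    rwa [sub_smul, one_smul, sub_sub_cancel] at this

/-- A cyclic module generated by a vector `g` killed by all `∂_i` with `i ≠ n`, on which the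
generic vector `∂_w g` is detected by `WordFn`, is free over `NH · u` with a basis indexed by words
with `n` letters `true`. -/
theorem nonempty_linearEquiv {n : ℕ} (hn : n ≤ N) {g : M}
    (hg : ∀ i : DIdx N, i.1.1 + 1 ≠ n → dg k N i • g = 0)
    (hspan : Submodule.span (NH k N) {g} = ⊤) (β : M →ₗ[NH k N] NH k N)
    (hβ : rho k N (β g) (wordSingle k (baseWord N n)) = wordSingle k (baseWord N n))
    {u : NH k N} (hu : u - 1 ∈ dIdeal k N) (hdu : ∀ i, dg k N i * u = 0) :
    Nonempty (({S : Fin N → Bool // numTrue S = n} → Submodule.span (NH k N) {u})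
      ≃ₗ[NH k N] M) := by
  choose G hG using fun S : {S : Fin N → Bool // numTrue S = n} =>
    exists_reach (k := k) n g S.2
  let Ψ : ({S : Fin N → Bool // numTrue S = n} → Submodule.span (NH k N) {u}) →ₗ[NH k N] M :=
    ∑ S, (LinearMap.toSpanSingleton (NH k N) M (G S)) ∘ₗ (Submodule.subtype _) ∘ₗ LinearMap.proj S
  have hΨ : ∀ p, Ψ p = ∑ S, (p S : NH k N) • G S := fun p => by
    simp [Ψ, LinearMap.sum_apply]
  refine ⟨LinearEquiv.ofBijective Ψ ⟨?_, ?_⟩⟩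
  · rw [← LinearMap.ker_eq_bot, LinearMap.ker_eq_bot']
    intro p hp
    choose f hf using fun S => exists_ev_mul_of_mem_span hdu (p S).2
    have := eq_zero_of_sum_rho_eq_zero hu (W := Subtype.val) Subtype.val_injective (f := f) (by
      rw [hΨ] at hp
      have := congrArg (fun m => rho k N (β m) (wordSingle k (baseWord N n))) hp
      simp only [map_sum, map_smul, map_zero, LinearMap.sum_apply, LinearMap.zero_apply,
        smul_eq_mul] at this
      rw [← this]
      refine Finset.sum_congr rfl fun S _ => ?_
      rw [hf, map_mul (rho k N) _ (β (G S)), Module.End.mul_apply, (hG S).rho_apply β hβ])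
    ext S
    rw [hf, this, map_zero, zero_mul]
    rfl
  · rw [← LinearMap.range_eq_top, eq_top_iff, ← hspan, Submodule.span_singleton_le_iff_mem]
    refine Reach.mem_of_smul_mem hn hg hu ?_ .base
    intro S m h
    refine ⟨Pi.single ⟨S, h.numTrue_eq hn⟩ ⟨u, Submodule.mem_span_singleton_self u⟩, ?_⟩
    rw [hΨ, Finset.sum_eq_single ⟨S, h.numTrue_eq hn⟩]
    · rw [Pi.single_eq_same, (hG ⟨S, h.numTrue_eq hn⟩).unique hn h]
    · intro T _ hT
      rw [Pi.single_eq_of_ne hT, ZeroMemClass.coe_zero, zero_smul]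
    · simp

theorem card_words (n : ℕ) : Fintype.card {S : Fin N → Bool // numTrue S = n} = N.choose n := by
  rw [← Fintype.card_fin N, ← Fintype.card_finset_len, Fintype.card_fin]
  refine Fintype.card_congr
    { toFun S := ⟨Finset.univ.filter fun i => S.1 i = true, S.2⟩
      invFun s := ⟨fun i => decide (i ∈ s.1), by simp [numTrue, s.2]⟩
      left_inv S := by simp
      right_inv s := by simp }

end Decomposition

section Induction

variable {k} {n m : ℕ} {φ : NH k n ⊗[k] NH k m →ₐ[k] NH k (n + m)}

theorem rho_phi_apply_baseWord (hφ : IsPhi k n m φ) {u : NH k n} (hu : u - 1 ∈ dIdeal k n)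
    {v : NH k m} (hv : v - 1 ∈ dIdeal k m) :
    rho k (n + m) (φ (u ⊗ₜ v)) (wordSingle k (baseWord (n + m) n)) =
      wordSingle k (baseWord (n + m) n) := by
  have hl : ∀ a ∈ dIdeal k n,
      rho k (n + m) (φ (a ⊗ₜ 1)) (wordSingle k (baseWord (n + m) n)) = 0 := by
    intro a ha
    induction ha using Submodule.span_induction with
    | mem a ha =>
      obtain ⟨i, rfl⟩ := ha
      rw [hφ.2.1, rho_dg_wordSingle_eq_zero]
      have := i.2
      simp [baseWord, this]
    | zero => simp
    | add a b _ _ ha hb =>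
      rw [TensorProduct.add_tmul, map_add, map_add, LinearMap.add_apply, ha, hb, add_zero]
    | smul c a _ ha =>
      rw [smul_eq_mul, ← mul_one (1 : NH k m), ← Algebra.TensorProduct.tmul_mul_tmul, map_mul,
        map_mul, Module.End.mul_apply, ha, map_zero]
  have hr : ∀ a ∈ dIdeal k m,
      rho k (n + m) (φ (1 ⊗ₜ a)) (wordSingle k (baseWord (n + m) n)) = 0 := by
    intro a ha
    induction ha using Submodule.span_induction with
    | mem a ha =>
      obtain ⟨i, rfl⟩ := ha
      rw [hφ.2.2.2, rho_dg_wordSingle_eq_zero]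
      simp [baseWord]
    | zero => simp
    | add a b _ _ ha hb =>
      rw [TensorProduct.tmul_add, map_add, map_add, LinearMap.add_apply, ha, hb, add_zero]
    | smul c a _ ha =>
      rw [smul_eq_mul, ← mul_one (1 : NH k n), ← Algebra.TensorProduct.tmul_mul_tmul, map_mul,
        map_mul, Module.End.mul_apply, ha, map_zero]
  have h1 : (1 : NH k n) ⊗ₜ[k] (1 : NH k m) = 1 := rfl
  have hu' := hl _ hu
  have hv' := hr _ hv
  rw [TensorProduct.sub_tmul, map_sub, map_sub, LinearMap.sub_apply, h1, map_one, map_one,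
    Module.End.one_apply, sub_eq_zero] at hu'
  rw [TensorProduct.tmul_sub, map_sub, map_sub, LinearMap.sub_apply, h1, map_one, map_one,
    Module.End.one_apply, sub_eq_zero] at hv'
  rw [← mul_one u, ← one_mul v, ← Algebra.TensorProduct.tmul_mul_tmul, map_mul, map_mul,
    Module.End.mul_apply, hv', hu']

section Pmod

variable (ψ : NH k n →ₗ[k] NH k n) (Dm : Equiv.Perm (Fin n) → NH k n)

/-- The generator of `Pmod`. -/
noncomputable def pgen : Pmod k n ψ Dm :=
  (⟨ψ (eElt k n Dm), Submodule.mem_span_singleton_self _⟩ :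
    Submodule.span (NH k n) {ψ (eElt k n Dm)})

/-- The inclusion of `Pmod`. -/
noncomputable def pincl : Pmod k n ψ Dm →ₗ[k] NH k n :=
  (Submodule.subtype (Submodule.span (NH k n) {ψ (eElt k n Dm)})).restrictScalars k

theorem pincl_pgen : pincl ψ Dm (pgen ψ Dm) = ψ (eElt k n Dm) := rfl

theorem pincl_smul (a : NH k n) (u : Pmod k n ψ Dm) : pincl ψ Dm (a • u) = a * pincl ψ Dm u := rfl

variable {ψ Dm}

theorem exists_smul_pgen (u : Pmod k n ψ Dm) : ∃ a : NH k n, u = a • pgen ψ Dm := by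
  obtain ⟨a, ha⟩ := Submodule.mem_span_singleton.mp (Subtype.property
    (p := (· ∈ Submodule.span (NH k n) {ψ (eElt k n Dm)})) u)
  exact ⟨a, Subtype.ext ha.symm⟩

theorem dg_smul_pgen (hψ : IsPsi k n ψ) (hDm : IsDfam k n Dm) (i : DIdx n) :
    dg k n i • pgen ψ Dm = 0 :=
  Subtype.ext (dg_mul_psi_eElt hψ hDm i)

end Pmod

variable (φ) (ψn : NH k n →ₗ[k] NH k n) (Dmn : Equiv.Perm (Fin n) → NH k n)
    (ψm : NH k m →ₗ[k] NH k m) (Dmm : Equiv.Perm (Fin m) → NH k m)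

/-- The balancing relations as a submodule over the nilHecke algebra. -/
noncomputable def indRel :
    Submodule (NH k (n + m)) (NH k (n + m) ⊗[k] (Pmod k n ψn Dmn ⊗[k] Pmod k m ψm Dmm)) where
  __ := indRelP k n m φ ψn Dmn ψm Dmm
  smul_mem' c z hz := by
    change c • z ∈ indRelP k n m φ ψn Dmn ψm Dmm
    replace hz : z ∈ indRelP k n m φ ψn Dmn ψm Dmm := hz
    induction hz using Submodule.span_induction with
    | mem z hz =>
      obtain ⟨T, a, b, u, v, rfl⟩ := hz
      refine Submodule.subset_span ⟨c * T, a, b, u, v, ?_⟩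
      rw [smul_sub, TensorProduct.smul_tmul', TensorProduct.smul_tmul', smul_eq_mul, smul_eq_mul,
        mul_assoc]
    | zero => simp
    | add x y _ _ hx hy =>
      rw [smul_add]
      exact add_mem hx hy
    | smul r x _ hx =>
      rw [smul_comm]
      exact Submodule.smul_mem _ r hx

/-- The map `T ⊗ (u ⊗ v) ↦ T * φ (u ⊗ v)`. -/
noncomputable def indMul : NH k (n + m) ⊗[k] (Pmod k n ψn Dmn ⊗[k] Pmod k m ψm Dmm) →ₗ[k]
    NH k (n + m) :=
  LinearMap.mul' k _ ∘ₗ TensorProduct.map .id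
    (φ.toLinearMap ∘ₗ TensorProduct.map (pincl ψn Dmn) (pincl ψm Dmm))

theorem indMul_tmul (T : NH k (n + m)) (u : Pmod k n ψn Dmn) (v : Pmod k m ψm Dmm) :
    indMul φ ψn Dmn ψm Dmm (T ⊗ₜ (u ⊗ₜ v)) = T * φ (pincl ψn Dmn u ⊗ₜ pincl ψm Dmm v) := by
  simp [indMul]

/-- `indMul` on the balanced tensor product. -/
noncomputable def indHom : ((NH k (n + m) ⊗[k] (Pmod k n ψn Dmn ⊗[k] Pmod k m ψm Dmm)) ⧸
    indRel φ ψn Dmn ψm Dmm) →ₗ[NH k (n + m)] NH k (n + m) :=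
  (indRel φ ψn Dmn ψm Dmm).liftQ
    { indMul φ ψn Dmn ψm Dmm with
      map_smul' c z := by
        change indMul φ ψn Dmn ψm Dmm (c • z) = c * indMul φ ψn Dmn ψm Dmm z
        induction z with
        | zero => simp
        | add x y hx hy => rw [smul_add, map_add, map_add, hx, hy, mul_add]
        | tmul T x =>
          induction x with
          | zero => simp
          | add x y hx hy =>
            rw [TensorProduct.tmul_add, smul_add, map_add, map_add, hx, hy, mul_add]
          | tmul u v =>
            rw [TensorProduct.smul_tmul', indMul_tmul, indMul_tmul, smul_eq_mul, mul_assoc] } <| by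
    intro z hz
    change indMul φ ψn Dmn ψm Dmm z = 0
    replace hz : z ∈ indRelP k n m φ ψn Dmn ψm Dmm := hz
    induction hz using Submodule.span_induction with
    | mem z hz =>
      obtain ⟨T, a, b, u, v, rfl⟩ := hz
      rw [map_sub, indMul_tmul, indMul_tmul, pincl_smul, pincl_smul,
        ← Algebra.TensorProduct.tmul_mul_tmul, map_mul, mul_assoc, sub_self]
    | zero => exact map_zero _
    | add x y _ _ hx hy => rw [map_add, hx, hy, add_zero]
    | smul r x _ hx => rw [map_smul, hx, smul_zero]

/-- The canonical generator of the induced module. -/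
noncomputable def indGen : (NH k (n + m) ⊗[k] (Pmod k n ψn Dmn ⊗[k] Pmod k m ψm Dmm)) ⧸
    indRel φ ψn Dmn ψm Dmm :=
  Submodule.Quotient.mk (1 ⊗ₜ (pgen ψn Dmn ⊗ₜ pgen ψm Dmm))

theorem indHom_indGen : indHom φ ψn Dmn ψm Dmm (indGen φ ψn Dmn ψm Dmm) =
    φ (ψn (eElt k n Dmn) ⊗ₜ ψm (eElt k m Dmm)) := by
  refine (indMul_tmul φ ψn Dmn ψm Dmm 1 (pgen ψn Dmn) (pgen ψm Dmm)).trans ?_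
  rw [one_mul, pincl_pgen, pincl_pgen]

theorem mk_smul_tmul_smul (T : NH k (n + m)) (a : NH k n) (b : NH k m) (u : Pmod k n ψn Dmn)
    (v : Pmod k m ψm Dmm) :
    (Submodule.Quotient.mk (T ⊗ₜ ((a • u) ⊗ₜ (b • v))) : _ ⧸ indRel φ ψn Dmn ψm Dmm) =
      (T * φ (a ⊗ₜ b)) • Submodule.Quotient.mk (1 ⊗ₜ (u ⊗ₜ v)) := by
  rw [← Submodule.Quotient.mk_smul, TensorProduct.smul_tmul', smul_eq_mul, mul_one, eq_comm,
    Submodule.Quotient.eq]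
  exact Submodule.subset_span ⟨T, a, b, u, v, rfl⟩

theorem span_indGen : Submodule.span (NH k (n + m)) {indGen φ ψn Dmn ψm Dmm} = ⊤ := by
  rw [eq_top_iff]
  rintro z -
  obtain ⟨z, rfl⟩ := Submodule.Quotient.mk_surjective _ z
  induction z with
  | zero => exact zero_mem _
  | add x y hx hy => exact add_mem hx hy
  | tmul T x =>
    induction x with
    | zero =>
      rw [TensorProduct.tmul_zero]
      exact zero_mem _
    | add x y hx hy =>
      rw [TensorProduct.tmul_add]
      exact add_mem hx hy
    | tmul u v =>
      obtain ⟨a, rfl⟩ := exists_smul_pgen u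
      obtain ⟨b, rfl⟩ := exists_smul_pgen v
      rw [mk_smul_tmul_smul]
      exact Submodule.smul_mem _ _ (Submodule.mem_span_singleton_self _)

variable {φ ψn Dmn ψm Dmm}

theorem dg_smul_indGen (hφ : IsPhi k n m φ) (hψn : IsPsi k n ψn) (hψm : IsPsi k m ψm)
    (hDmn : IsDfam k n Dmn) (hDmm : IsDfam k m Dmm) (i : DIdx (n + m)) (hi : i.1.1 + 1 ≠ n) :
    dg k (n + m) i • indGen φ ψn Dmn ψm Dmm = 0 := by
  rcases lt_or_ge (i.1.1 + 1) n with h | h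
  · have e : dg k (n + m) i = φ (dg k n ⟨⟨i.1.1, by omega⟩, h⟩ ⊗ₜ 1) :=
      (hφ.2.1 ⟨⟨i.1.1, by omega⟩, h⟩).symm
    have := mk_smul_tmul_smul φ ψn Dmn ψm Dmm 1 (dg k n ⟨⟨i.1.1, by omega⟩, h⟩) 1
      (pgen ψn Dmn) (pgen ψm Dmm)
    rw [one_mul, ← e, dg_smul_pgen hψn hDmn, TensorProduct.zero_tmul,
      TensorProduct.tmul_zero] at this
    exact this.symm
  · have hi' := i.2
    let j : DIdx m := ⟨⟨i.1.1 - n, by omega⟩, by simp only; omega⟩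
    have e : dg k (n + m) i = φ (1 ⊗ₜ dg k m j) := by
      rw [hφ.2.2.2]
      congr 1
      refine Subtype.ext (Fin.ext ?_)
      simp only [Fin.val_natAdd, j]
      omega
    have := mk_smul_tmul_smul φ ψn Dmn ψm Dmm 1 1 (dg k m j) (pgen ψn Dmn) (pgen ψm Dmm)
    rw [one_mul, ← e, dg_smul_pgen hψm hDmm, TensorProduct.tmul_zero,
      TensorProduct.tmul_zero] at this
    exact this.symm

end Induction

end NilHecke

set_option synthInstance.maxHeartbeats 1000000 in
set_option maxHeartbeats 1000000 in
/-- let `k` be a field, `n, m ≥ 1`, `ψ_N` the anti-involution of `NH_N`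
fixing the generators, and `P_N := NH_N · ψ_N(e_N)`.  Then, disregarding gradings,
there is an isomorphism of left `NH_{n+m}`-modules
`NH_{n+m} ⊗_{NH_n ⊗ NH_m} (P_n ⊗_k P_m) ≅ P_{n+m}^{⊕ C(n+m,n)}`, where `C(n+m,n)` is
an ordinary binomial coefficient.  The isomorphism is realized as a `k`-linear
equivalence which is `NH_{n+m}`-equivariant (equivariance being expressed on
representatives of the balanced tensor product). -/
theorem stmt_19 (n m : ℕ) (hn : 1 ≤ n) (hm : 1 ≤ m)
    (φ : NH k n ⊗[k] NH k m →ₐ[k] NH k (n + m)) (hφ : IsPhi k n m φ)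
    (ψn : NH k n →ₗ[k] NH k n) (hψn : IsPsi k n ψn)
    (ψm : NH k m →ₗ[k] NH k m) (hψm : IsPsi k m ψm)
    (ψ : NH k (n + m) →ₗ[k] NH k (n + m)) (hψ : IsPsi k (n + m) ψ)
    (Dmn : Equiv.Perm (Fin n) → NH k n) (hDmn : IsDfam k n Dmn)
    (Dmm : Equiv.Perm (Fin m) → NH k m) (hDmm : IsDfam k m Dmm)
    (Dm : Equiv.Perm (Fin (n + m)) → NH k (n + m)) (hDm : IsDfam k (n + m) Dm) :
    ∃ e : ((NH k (n + m) ⊗[k] (Pmod k n ψn Dmn ⊗[k] Pmod k m ψm Dmm))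
            ⧸ indRelP k n m φ ψn Dmn ψm Dmm)
        ≃ₗ[k] (Fin (Nat.choose (n + m) n) → Pmod k (n + m) ψ Dm),
      ∀ (S T : NH k (n + m)) (u : Pmod k n ψn Dmn) (v : Pmod k m ψm Dmm),
        e (Submodule.Quotient.mk ((S * T) ⊗ₜ[k] (u ⊗ₜ[k] v)))
          = S • e (Submodule.Quotient.mk (T ⊗ₜ[k] (u ⊗ₜ[k] v))) := by
  obtain ⟨Ψ⟩ := NilHecke.nonempty_linearEquiv (Nat.le_add_right n m)
    (NilHecke.dg_smul_indGen hφ hψn hψm hDmn hDmm) (NilHecke.span_indGen φ ψn Dmn ψm Dmm)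
    (NilHecke.indHom φ ψn Dmn ψm Dmm)
    (by
      rw [NilHecke.indHom_indGen]
      exact NilHecke.rho_phi_apply_baseWord hφ (NilHecke.psi_eElt_sub_one_mem hψn hDmn)
        (NilHecke.psi_eElt_sub_one_mem hψm hDmm))
    (NilHecke.psi_eElt_sub_one_mem hψ hDm) (NilHecke.dg_mul_psi_eElt hψ hDm)
  let E := Ψ.symm ≪≫ₗ LinearEquiv.funCongrLeft (NH k (n + m)) _
    (Fintype.equivFinOfCardEq (NilHecke.card_words n)).symm
  refine ⟨(Submodule.Quotient.restrictScalarsEquiv k (NilHecke.indRel φ ψn Dmn ψm Dmm)) ≪≫ₗ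
    E.restrictScalars k, fun S T u v => ?_⟩
  exact map_smul E S (Submodule.Quotient.mk (T ⊗ₜ[k] (u ⊗ₜ[k] v)))
end
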